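/- Let the pressure be p(ρ) = ρ^γ with γ ≥ 1. Let ρ₋, ρ₊ > 0 with ρ₋ ≠ ρ₊, let v₊₂ ∈ ℝ and v₋₁, v₊₁ ∈ ℝ be arbitrary. Then there exists V̄ = V̄(ρ₋, ρ₊, v₊₂, γ) < √((ρ₊ − ρ₋)(p(ρ₊) − p(ρ₋))/(ρ₊ρ₋)) such that whenever V̄ < v₋₂ − v₊₂ < √((ρ₊ − ρ₋)(p(ρ₊) − p(ρ₋))/(ρ₊ρ₋)), there exists an admissible fan subsolution of the 2D isentropic Euler system with the Riemann initial data determined by (ρ₋, v₋) and (ρ₊, v₊). -/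

import Mathlib

open MeasureTheory Matrix

noncomputable section

/-- Space-time point: `(x, t)` with `x ∈ ℝ²` (spatial variable) and `t ∈ ℝ` (time). -/
abbrev SpaceTime : Type := (Fin 2 → ℝ) × ℝ

/-- A test function: smooth and compactly supported on `ℝ² × ℝ`. -/
def IsTest (φ : SpaceTime → ℝ) : Prop :=
  ContDiff ℝ (⊤ : ℕ∞) φ ∧ HasCompactSupport φ

/-- Time partial derivative `∂_t φ`. -/
def pdt (φ : SpaceTime → ℝ) (q : SpaceTime) : ℝ := fderiv ℝ φ q (0, 1)

/-- Spatial partial derivative `∂_{x_i} φ`. -/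
def pdx (i : Fin 2) (φ : SpaceTime → ℝ) (q : SpaceTime) : ℝ :=
  fderiv ℝ φ q (Pi.single i 1, 0)

/-- The set of space-time points with positive time, i.e. `ℝ² × (0,∞)`. -/
def posTime : Set SpaceTime := {q | 0 < q.2}

/-- Riemann initial data for the density. -/
def riemannRho (ρm ρp : ℝ) (x : Fin 2 → ℝ) : ℝ := if x 1 < 0 then ρm else ρp

/-- Riemann initial data for the velocity. -/
def riemannV (vm vp : Fin 2 → ℝ) (x : Fin 2 → ℝ) : Fin 2 → ℝ :=
  if x 1 < 0 then vm else vp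

/-- Squared euclidean norm `|v|²` of a vector `v ∈ ℝ²`. -/
def sq2 (v : Fin 2 → ℝ) : ℝ := ∑ i, v i ^ 2

/-- `(ρ, v)` is a weak solution (in the sense of distributions, with the initial data
`(ρ0, v0)` entering through the `t = 0` boundary term) of the compressible isentropic
Euler system `∂_t ρ + div_x (ρ v) = 0`, `∂_t (ρ v) + div_x (ρ v ⊗ v) + ∇_x p(ρ) = 0`
on `ℝ² × (0,∞)`, with pressure law `p`. -/
def IsWeakSolution (p : ℝ → ℝ) (ρ0 : (Fin 2 → ℝ) → ℝ) (v0 : (Fin 2 → ℝ) → Fin 2 → ℝ)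
    (ρ : SpaceTime → ℝ) (v : SpaceTime → Fin 2 → ℝ) : Prop :=
  (∀ φ : SpaceTime → ℝ, IsTest φ →
    (∫ q in posTime, (ρ q * pdt φ q + ∑ i, ρ q * v q i * pdx i φ q))
      + (∫ x, ρ0 x * φ (x, 0)) = 0) ∧
  (∀ j : Fin 2, ∀ φ : SpaceTime → ℝ, IsTest φ →
    (∫ q in posTime,
        (ρ q * v q j * pdt φ q + (∑ i, ρ q * v q j * v q i * pdx i φ q)
          + p (ρ q) * pdx j φ q))
      + (∫ x, ρ0 x * v0 x j * φ (x, 0)) = 0)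

/-- `(ρ, v)` satisfies the weak form of the entropy (energy) inequality with pressure `p`,
internal energy `ε`, and initial data `(ρ0, v0)`: for every nonnegative test function `φ`,
`∫∫ [(ρε(ρ)+ρ|v|²/2) ∂_t φ + (ρε(ρ)+ρ|v|²/2+p(ρ)) v · ∇_x φ] + ∫ (ρ⁰ε(ρ⁰)+ρ⁰|v⁰|²/2) φ(·,0) ≥ 0`. -/
def IsAdmissibleSolution (p ε : ℝ → ℝ) (ρ0 : (Fin 2 → ℝ) → ℝ)
    (v0 : (Fin 2 → ℝ) → Fin 2 → ℝ)
    (ρ : SpaceTime → ℝ) (v : SpaceTime → Fin 2 → ℝ) : Prop :=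
  ∀ φ : SpaceTime → ℝ, IsTest φ → (∀ q, 0 ≤ φ q) →
    0 ≤ (∫ q in posTime,
          ((ρ q * ε (ρ q) + ρ q * sq2 (v q) / 2) * pdt φ q
            + ∑ i, (ρ q * ε (ρ q) + ρ q * sq2 (v q) / 2 + p (ρ q)) * v q i * pdx i φ q))
        + (∫ x, (ρ0 x * ε (ρ0 x) + ρ0 x * sq2 (v0 x) / 2) * φ (x, 0))

/-- Internal energy density associated with the pressure law `p(ρ) = ρ^γ` via
`p(r) = r² ε'(r)`: `ε(ρ) = ρ^(γ-1)/(γ-1)` for `γ > 1` and `ε(ρ) = log ρ` for `γ = 1`. -/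
def intEnergy (γ : ℝ) (r : ℝ) : ℝ :=
  if γ = 1 then Real.log r else r ^ (γ - 1) / (γ - 1)

/-- The pressure law `p(ρ) = ρ^γ`. -/
def pressure (γ : ℝ) (r : ℝ) : ℝ := r ^ γ

/-- `(ρ, v)` is a bounded admissible weak solution of the 2D isentropic Euler system
with pressure `p`, internal energy `ε`, and initial data `(ρ0, v0)`: it is measurable,
takes values in `(0,∞) × ℝ²`, is (essentially) bounded, is a weak solution, and
satisfies the weak energy inequality. -/
def IsBddAdmissibleSolutionGen (p ε : ℝ → ℝ) (ρ0 : (Fin 2 → ℝ) → ℝ)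
    (v0 : (Fin 2 → ℝ) → Fin 2 → ℝ)
    (ρ : SpaceTime → ℝ) (v : SpaceTime → Fin 2 → ℝ) : Prop :=
  Measurable ρ ∧ Measurable v ∧ (∀ q, 0 < ρ q) ∧
  (∃ M : ℝ, ∀ q, ρ q ≤ M ∧ ∀ i, |v q i| ≤ M) ∧
  IsWeakSolution p ρ0 v0 ρ v ∧ IsAdmissibleSolution p ε ρ0 v0 ρ v

/-- `(ρ, v)` is a bounded admissible weak solution of the 2D isentropic Euler system with
pressure `p(ρ) = ρ^γ` and Riemann initial data given by `(ρm, vm)` for `x₂ < 0` and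
`(ρp, vp)` for `x₂ > 0`. -/
def IsBddAdmissibleRiemannSolution (γ ρm ρp : ℝ) (vm vp : Fin 2 → ℝ)
    (ρ : SpaceTime → ℝ) (v : SpaceTime → Fin 2 → ℝ) : Prop :=
  IsBddAdmissibleSolutionGen (pressure γ) (intEnergy γ)
    (riemannRho ρm ρp) (riemannV vm vp) ρ v

/-- A matrix in `𝒮₀^{2×2}`: symmetric and trace-free. -/
def IsS0 (u : Matrix (Fin 2) (Fin 2) ℝ) : Prop := u.IsSymm ∧ u.trace = 0

/-- The outer product `v ⊗ v` of a vector `v ∈ ℝ²`. -/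
def outer (v : Fin 2 → ℝ) : Matrix (Fin 2) (Fin 2) ℝ := vecMulVec v v

/-- The traceless part `v ⊗ v − ½|v|² Id` used for the states `u₋, u₊`. -/
def uPM (v : Fin 2 → ℝ) : Matrix (Fin 2) (Fin 2) ℝ :=
  outer v - (sq2 v / 2) • (1 : Matrix (Fin 2) (Fin 2) ℝ)

/-- The piecewise constant field on the fan partition determined by `ν₋ < ν₁ < ν₊`,
taking values `am, a1, a2, ap` on `P₋, P₁, P₂, P₊` respectively. -/
def fanField {α : Type} (νm ν1 νp : ℝ) (am a1 a2 ap : α) (q : SpaceTime) : α :=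
  if q.1 1 < νm * q.2 then am else if q.1 1 < ν1 * q.2 then a1
  else if q.1 1 < νp * q.2 then a2 else ap

/-- The region `P₁ = {(x,t) : t > 0, ν₋ t < x₂ < ν₁ t}` of a fan partition. -/
def fanP1 (νm ν1 : ℝ) : Set SpaceTime :=
  {q | 0 < q.2 ∧ νm * q.2 < q.1 1 ∧ q.1 1 < ν1 * q.2}

/-- The region `P₂ = {(x,t) : t > 0, ν₁ t < x₂ < ν₊ t}` of a fan partition. -/
def fanP2 (ν1 νp : ℝ) : Set SpaceTime :=
  {q | 0 < q.2 ∧ ν1 * q.2 < q.1 1 ∧ q.1 1 < νp * q.2}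

/-- Fan subsolution to the 2D isentropic compressible Euler system with pressure law `p`
and Riemann initial data `(ρm, vm)`, `(ρp, vp)`, built from the fan partition determined
by `ν₋ < ν₁ < ν₊`, middle states `(ρ₁, v₁, u₁)`, `(ρ₂, v₂, u₂)` and constants `C₁, C₂`:
the subsolution conditions `(Cᵢ/2)Id − vᵢ⊗vᵢ + uᵢ > 0` hold, and the relaxed continuity
and momentum equations hold in the sense of distributions (with the Riemann initial data
in the `t = 0` boundary terms). -/
def IsFanSubsolution (p : ℝ → ℝ) (ρm ρp : ℝ) (vm vp : Fin 2 → ℝ)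
    (νm ν1 νp ρ1 ρ2 : ℝ) (v1 v2 : Fin 2 → ℝ) (u1 u2 : Matrix (Fin 2) (Fin 2) ℝ)
    (C1 C2 : ℝ) : Prop :=
  νm < ν1 ∧ ν1 < νp ∧ 0 < ρ1 ∧ 0 < ρ2 ∧ IsS0 u1 ∧ IsS0 u2 ∧ 0 < C1 ∧ 0 < C2 ∧
  ((C1 / 2) • (1 : Matrix (Fin 2) (Fin 2) ℝ) - outer v1 + u1).PosDef ∧
  ((C2 / 2) • (1 : Matrix (Fin 2) (Fin 2) ℝ) - outer v2 + u2).PosDef ∧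
  -- continuity equation ∂_t ρ̄ + div_x (ρ̄ v̄) = 0
  (∀ φ : SpaceTime → ℝ, IsTest φ →
    (∫ q in posTime,
        (fanField νm ν1 νp ρm ρ1 ρ2 ρp q * pdt φ q
          + ∑ i, fanField νm ν1 νp (ρm * vm i) (ρ1 * v1 i) (ρ2 * v2 i) (ρp * vp i) q
              * pdx i φ q))
      + (∫ x, riemannRho ρm ρp x * φ (x, 0)) = 0) ∧
  -- momentum equation ∂_t(ρ̄ v̄) + div_x(ρ̄ ū) + ∇_x(p(ρ̄) + ½(ρ̄|v̄|²𝟙_{P₊∪P₋} + Σ Cᵢρᵢ𝟙_{Pᵢ})) = 0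
  (∀ j : Fin 2, ∀ φ : SpaceTime → ℝ, IsTest φ →
    (∫ q in posTime,
        (fanField νm ν1 νp (ρm * vm j) (ρ1 * v1 j) (ρ2 * v2 j) (ρp * vp j) q * pdt φ q
          + (∑ i, fanField νm ν1 νp (ρm * uPM vm j i) (ρ1 * u1 j i) (ρ2 * u2 j i)
                (ρp * uPM vp j i) q * pdx i φ q)
          + fanField νm ν1 νp (p ρm + ρm * sq2 vm / 2) (p ρ1 + C1 * ρ1 / 2)
              (p ρ2 + C2 * ρ2 / 2) (p ρp + ρp * sq2 vp / 2) q * pdx j φ q))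
      + (∫ x, riemannRho ρm ρp x * riemannV vm vp x j * φ (x, 0)) = 0)

/-- The total energy density of a fan subsolution:
`ρ̄ε(ρ̄) + ρ̄|v̄|²/2` on `P₋ ∪ P₊` and `ρᵢε(ρᵢ) + ρᵢCᵢ/2` on `Pᵢ`. -/
def fanEnergy (ε : ℝ → ℝ) (ρm ρp : ℝ) (vm vp : Fin 2 → ℝ)
    (νm ν1 νp ρ1 ρ2 C1 C2 : ℝ) (q : SpaceTime) : ℝ :=
  fanField νm ν1 νp (ρm * ε ρm + ρm * sq2 vm / 2) (ρ1 * ε ρ1 + ρ1 * C1 / 2)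
    (ρ2 * ε ρ2 + ρ2 * C2 / 2) (ρp * ε ρp + ρp * sq2 vp / 2) q

/-- Admissible fan subsolution: a fan subsolution which moreover satisfies the relaxed
energy inequality in the sense of distributions on `ℝ² × (0,∞)`. -/
def IsAdmissibleFanSubsolution (p ε : ℝ → ℝ) (ρm ρp : ℝ) (vm vp : Fin 2 → ℝ)
    (νm ν1 νp ρ1 ρ2 : ℝ) (v1 v2 : Fin 2 → ℝ) (u1 u2 : Matrix (Fin 2) (Fin 2) ℝ)
    (C1 C2 : ℝ) : Prop :=
  IsFanSubsolution p ρm ρp vm vp νm ν1 νp ρ1 ρ2 v1 v2 u1 u2 C1 C2 ∧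
  (∀ φ : SpaceTime → ℝ, IsTest φ → (∀ q, 0 ≤ φ q) → tsupport φ ⊆ posTime →
    0 ≤ ∫ q in posTime,
        (fanEnergy ε ρm ρp vm vp νm ν1 νp ρ1 ρ2 C1 C2 q * pdt φ q
          + ∑ i, (fanEnergy ε ρm ρp vm vp νm ν1 νp ρ1 ρ2 C1 C2 q
                + fanField νm ν1 νp (p ρm) (p ρ1) (p ρ2) (p ρp) q)
              * fanField νm ν1 νp (vm i) (v1 i) (v2 i) (vp i) q * pdx i φ q))

open Set

section Integrals

variable {φ : SpaceTime → ℝ}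

/-- Restriction of a test function to a line. -/
def alongLine (φ : SpaceTime → ℝ) (q w : SpaceTime) (s : ℝ) : ℝ := φ (q + s • w)

lemma IsTest.contDiff_alongLine (h : IsTest φ) (q w : SpaceTime) :
    ContDiff ℝ 1 (alongLine φ q w) := by
  have h1 : ContDiff ℝ 1 φ := h.1.of_le (by exact_mod_cast le_top)
  unfold alongLine
  fun_prop

lemma IsTest.hasCompactSupport_alongLine (h : IsTest φ) (q : SpaceTime) {w : SpaceTime}
    (hw : w ≠ 0) : HasCompactSupport (alongLine φ q w) :=
  h.2.comp_isClosedEmbedding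
    ((Homeomorph.addLeft q).isClosedEmbedding.comp (isClosedEmbedding_smul_left hw))

lemma IsTest.differentiable (h : IsTest φ) : Differentiable ℝ φ :=
  h.1.differentiable (by simp)

lemma IsTest.deriv_alongLine (h : IsTest φ) (q w : SpaceTime) (s : ℝ) :
    deriv (alongLine φ q w) s = fderiv ℝ φ (q + s • w) w := by
  have h1 : HasDerivAt (fun s : ℝ => q + s • w) w s := by
    simpa using ((hasDerivAt_id s).smul_const w).const_add q
  exact ((h.differentiable (q + s • w)).hasFDerivAt.comp_hasDerivAt s h1).deriv

lemma IsTest.integral_line_eq_zero (h : IsTest φ) (q : SpaceTime) {w : SpaceTime} (hw : w ≠ 0) :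
    ∫ s : ℝ, fderiv ℝ φ (q + s • w) w = 0 := by
  have h1 := h.contDiff_alongLine q w
  have h2 := h.hasCompactSupport_alongLine q hw
  simp_rw [← h.deriv_alongLine]
  exact integral_eq_zero_of_hasDerivAt_of_integrable
    (fun s => (h1.differentiable one_ne_zero s).hasDerivAt)
    ((h1.continuous_deriv le_rfl).integrable_of_hasCompactSupport h2.deriv)
    (h1.continuous.integrable_of_hasCompactSupport h2)

lemma IsTest.integral_Ioi_line (h : IsTest φ) (q : SpaceTime) {w : SpaceTime} (hw : w ≠ 0) (b : ℝ) :
    ∫ s in Ioi b, fderiv ℝ φ (q + s • w) w = - φ (q + b • w) := by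
  simp_rw [← h.deriv_alongLine]
  exact HasCompactSupport.integral_Ioi_deriv_eq (h.contDiff_alongLine q w)
    (h.hasCompactSupport_alongLine q hw) b

lemma IsTest.integral_Iio_line (h : IsTest φ) (q : SpaceTime) {w : SpaceTime} (hw : w ≠ 0) (b : ℝ) :
    ∫ s in Iio b, fderiv ℝ φ (q + s • w) w = φ (q + b • w) := by
  rw [← integral_Iic_eq_integral_Iio]
  simp_rw [← h.deriv_alongLine]
  exact HasCompactSupport.integral_Iic_deriv_eq (h.contDiff_alongLine q w)
    (h.hasCompactSupport_alongLine q hw) b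

lemma IsTest.integrable_fderiv (h : IsTest φ) (w : SpaceTime) :
    Integrable (fun q => fderiv ℝ φ q w) := by
  have h1 : Continuous (fderiv ℝ φ) := h.1.continuous_fderiv (by simp)
  exact (h1.clm_apply continuous_const).integrable_of_hasCompactSupport (h.2.fderiv_apply ℝ w)

lemma IsTest.integrable_fderiv_slice (h : IsTest φ) (w : SpaceTime) (t : ℝ) :
    Integrable (fun x : Fin 2 → ℝ => fderiv ℝ φ (x, t) w) := by
  have h1 : Continuous (fderiv ℝ φ) := h.1.continuous_fderiv (by simp)
  have h2 : Topology.IsClosedEmbedding (fun x : Fin 2 → ℝ => (x, t)) :=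
    Topology.IsClosedEmbedding.of_continuous_injective_isClosedMap (by fun_prop)
      (fun x y hxy => congrArg Prod.fst hxy) (isClosedMap_prodMk_right t)
  exact Continuous.integrable_of_hasCompactSupport (by fun_prop)
    ((h.2.fderiv_apply ℝ w).comp_isClosedEmbedding h2)

lemma IsTest.integrable_slice (h : IsTest φ) (t : ℝ) :
    Integrable (fun x : Fin 2 → ℝ => φ (x, t)) := by
  have h1 : Continuous φ := h.1.continuous
  have h2 : Topology.IsClosedEmbedding (fun x : Fin 2 → ℝ => (x, t)) :=
    Topology.IsClosedEmbedding.of_continuous_injective_isClosedMap (by fun_prop)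
      (fun x y hxy => congrArg Prod.fst hxy) (isClosedMap_prodMk_right t)
  exact Continuous.integrable_of_hasCompactSupport (by fun_prop) (h.2.comp_isClosedEmbedding h2)

lemma IsTest.integrable_pdt (h : IsTest φ) : Integrable (pdt φ) := h.integrable_fderiv _

lemma IsTest.integrable_pdx (h : IsTest φ) (i : Fin 2) : Integrable (pdx i φ) :=
  h.integrable_fderiv _

lemma IsTest.integrable_slice_pdx (h : IsTest φ) (i : Fin 2) (t : ℝ) :
    Integrable (fun x : Fin 2 → ℝ => pdx i φ (x, t)) :=
  h.integrable_fderiv_slice _ t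

lemma integral_fin_two (G : (Fin 2 → ℝ) → ℝ) : ∫ x, G x = ∫ p : ℝ × ℝ, G ![p.1, p.2] :=
  (((volume_preserving_finTwoArrow ℝ).symm _).integral_comp' G).symm

lemma integrable_fin_two {G : (Fin 2 → ℝ) → ℝ} (hG : Integrable G) :
    Integrable (fun p : ℝ × ℝ => G ![p.1, p.2]) :=
  (((volume_preserving_finTwoArrow ℝ).symm _).integrable_comp_emb
    (MeasurableEquiv.measurableEmbedding _)).2 hG

lemma IsTest.setIntegral_slice_pdx_zero (h : IsTest φ) {s : Set ℝ} (hs : MeasurableSet s)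
    (t : ℝ) : ∫ x in {x : Fin 2 → ℝ | x 1 ∈ s}, pdx 0 φ (x, t) = 0 := by
  have hm : MeasurableSet {x : Fin 2 → ℝ | x 1 ∈ s} := measurable_pi_apply 1 hs
  have hi := (h.integrable_slice_pdx 0 t).indicator hm
  rw [← integral_indicator hm, integral_fin_two, Measure.volume_eq_prod]
  refine (integral_prod_symm _ (integrable_fin_two hi)).trans ?_
  refine integral_eq_zero_of_ae (Filter.Eventually.of_forall fun y => ?_)
  have key := h.integral_line_eq_zero (![0, y], t) (w := (Pi.single 0 1, 0)) (by
    intro hh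
    have := congrFun (congrArg Prod.fst hh) 0
    simp at this)
  by_cases hy : y ∈ s
  · have hl : ∀ x : ℝ, ({x : Fin 2 → ℝ | x 1 ∈ s}.indicator (fun x => pdx 0 φ (x, t)) ![x, y])
        = fderiv ℝ φ ((![0, y], t) + x • ((Pi.single 0 1, 0) : SpaceTime))
            (Pi.single 0 1, 0) := by
      intro x
      rw [indicator_of_mem (by simpa using hy)]
      unfold pdx
      congr 2
      exact Prod.ext (by ext i; fin_cases i <;> simp [vecHead, vecTail]) (by simp)
    simp only [hl, Pi.zero_apply]
    exact key
  · simp [indicator, hy]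

lemma slice_pdx_one_line (φ : SpaceTime → ℝ) (x y t : ℝ) :
    pdx 1 φ (![x, y], t) =
      fderiv ℝ φ ((![x, 0], t) + y • ((Pi.single 1 1, 0) : SpaceTime)) (Pi.single 1 1, 0) := by
  unfold pdx
  congr 2
  exact Prod.ext (by ext i; fin_cases i <;> simp [vecHead, vecTail]) (by simp)

lemma single_one_ne_zero : ((Pi.single 1 1, 0) : SpaceTime) ≠ 0 := by
  intro hh
  have := congrFun (congrArg Prod.fst hh) 1
  simp at this

lemma IsTest.integral_slice_pdx_one (h : IsTest φ) (t : ℝ) :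
    ∫ x : Fin 2 → ℝ, pdx 1 φ (x, t) = 0 := by
  have hi := h.integrable_slice_pdx 1 t
  rw [integral_fin_two, Measure.volume_eq_prod]
  refine (integral_prod _ (integrable_fin_two hi)).trans ?_
  refine integral_eq_zero_of_ae (Filter.Eventually.of_forall fun x => ?_)
  have key := h.integral_line_eq_zero (![x, 0], t) single_one_ne_zero
  simp only [← slice_pdx_one_line] at key
  exact key

lemma IsTest.setIntegral_slice_pdx_one_nonneg (h : IsTest φ) (h0 : ∀ q, 0 ≤ φ q) (c t : ℝ) :
    0 ≤ ∫ x in {x : Fin 2 → ℝ | x 1 ∈ Iio c}, pdx 1 φ (x, t) := by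
  have hm : MeasurableSet {x : Fin 2 → ℝ | x 1 ∈ Iio c} := measurable_pi_apply 1 measurableSet_Iio
  have hi := (h.integrable_slice_pdx 1 t).indicator hm
  rw [← integral_indicator hm, integral_fin_two, Measure.volume_eq_prod]
  refine le_of_le_of_eq ?_ (integral_prod _ (integrable_fin_two hi)).symm
  refine integral_nonneg fun x => ?_
  have key := h.integral_Iio_line (![x, 0], t) single_one_ne_zero c
  have : ∫ y, {x : Fin 2 → ℝ | x 1 ∈ Iio c}.indicator (fun x => pdx 1 φ (x, t)) ![x, y]
      = φ ((![x, 0], t) + c • ((Pi.single 1 1, 0) : SpaceTime)) := by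
    rw [← key, ← integral_indicator measurableSet_Iio]
    congr 1
    ext y
    by_cases hy : y < c
    · simp [indicator, hy, slice_pdx_one_line]
    · simp [indicator, hy]
  exact this ▸ h0 _

/-- Space-time region `{t > 0, x₂ < ν t}`. -/
def belowRay (ν : ℝ) : Set SpaceTime := {q | 0 < q.2 ∧ q.1 1 < ν * q.2}

lemma measurableSet_belowRay (ν : ℝ) : MeasurableSet (belowRay ν) :=
  (measurableSet_lt (f := fun _ => (0 : ℝ)) (g := fun q : SpaceTime => q.2) (by fun_prop)
    (by fun_prop)).inter (measurableSet_lt (f := fun q : SpaceTime => q.1 1)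
      (g := fun q => ν * q.2) (by fun_prop) (by fun_prop))

lemma measurableSet_posTime : MeasurableSet posTime :=
  measurableSet_lt measurable_const measurable_snd

lemma setIntegral_belowRay {g : SpaceTime → ℝ} (hg : Integrable g) (ν : ℝ) :
    ∫ q in belowRay ν, g q
      = ∫ t in Ioi (0 : ℝ), ∫ x in {x : Fin 2 → ℝ | x 1 ∈ Iio (ν * t)}, g (x, t) := by
  have hi := hg.indicator (measurableSet_belowRay ν)
  rw [← integral_indicator (measurableSet_belowRay ν), ← integral_indicator measurableSet_Ioi,
    Measure.volume_eq_prod, integral_prod_symm _ hi]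
  congr 1
  ext t
  by_cases ht : 0 < t
  · have hm : MeasurableSet {x : Fin 2 → ℝ | x 1 ∈ Iio (ν * t)} :=
      measurable_pi_apply 1 measurableSet_Iio
    rw [indicator_of_mem (show t ∈ Ioi (0 : ℝ) from ht), ← integral_indicator hm]
    simp [indicator, belowRay, ht]
  · simp [indicator, belowRay, ht]

lemma setIntegral_posTime {g : SpaceTime → ℝ} (hg : Integrable g) :
    ∫ q in posTime, g q = ∫ t in Ioi (0 : ℝ), ∫ x, g (x, t) := by
  have hi := hg.indicator measurableSet_posTime
  rw [← integral_indicator measurableSet_posTime, ← integral_indicator measurableSet_Ioi,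
    Measure.volume_eq_prod, integral_prod_symm _ hi]
  congr 1
  ext t
  by_cases ht : 0 < t
  · simp [indicator, posTime, ht]
  · simp [indicator, posTime, ht]

lemma IsTest.setIntegral_belowRay_pdx_zero (h : IsTest φ) (ν : ℝ) :
    ∫ q in belowRay ν, pdx 0 φ q = 0 := by
  rw [setIntegral_belowRay (h.integrable_pdx 0)]
  have := fun t => h.setIntegral_slice_pdx_zero (measurableSet_Iio (a := ν * t)) t
  simp only [this, integral_zero]

lemma IsTest.setIntegral_posTime_pdx (h : IsTest φ) (i : Fin 2) :
    ∫ q in posTime, pdx i φ q = 0 := by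
  rw [setIntegral_posTime (h.integrable_pdx i)]
  fin_cases i
  · have := fun t => h.setIntegral_slice_pdx_zero MeasurableSet.univ t
    simp only [mem_univ, ofPred_true, Measure.restrict_univ] at this
    simp [this]
  · simp [h.integral_slice_pdx_one]

lemma IsTest.setIntegral_belowRay_pdx_one_nonneg (h : IsTest φ) (h0 : ∀ q, 0 ≤ φ q) (ν : ℝ) :
    0 ≤ ∫ q in belowRay ν, pdx 1 φ q := by
  rw [setIntegral_belowRay (h.integrable_pdx 1)]
  exact integral_nonneg fun t => h.setIntegral_slice_pdx_one_nonneg h0 _ _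

lemma IsTest.setIntegral_prod_pdt (h : IsTest φ) {A : Set (Fin 2 → ℝ)} :
    ∫ q in A ×ˢ Ioi (0 : ℝ), pdt φ q = - ∫ x in A, φ (x, 0) := by
  rw [Measure.volume_eq_prod, setIntegral_prod _ h.integrable_pdt.integrableOn,
    ← integral_neg]
  congr 1
  ext x
  have key := h.integral_Ioi_line (x, 0) (w := (0, 1)) (by simp) 0
  simp only [Prod.smul_mk, smul_zero, smul_eq_mul, mul_one, Prod.mk_add_mk, add_zero, zero_add]
    at key
  exact key

lemma IsTest.setIntegral_posTime_pdt (h : IsTest φ) :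
    ∫ q in posTime, pdt φ q = - ∫ x, φ (x, 0) := by
  have : posTime = univ ×ˢ Ioi (0 : ℝ) := by ext; simp [posTime]
  rw [this, h.setIntegral_prod_pdt, Measure.restrict_univ]

/-- Galilean shear of space-time in the `x₂`-direction with speed `ν`. -/
def shear (ν : ℝ) : SpaceTime ≃L[ℝ] SpaceTime :=
  LinearEquiv.toContinuousLinearEquiv
    { toFun := fun q => (q.1 + (ν * q.2) • Pi.single 1 1, q.2)
      invFun := fun q => (q.1 - (ν * q.2) • Pi.single 1 1, q.2)
      map_add' := fun q r => by
        ext i <;> simp; ring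
      map_smul' := fun c q => by
        ext i <;> simp; ring
      left_inv := fun q => by simp
      right_inv := fun q => by simp }

lemma shear_apply (ν : ℝ) (q : SpaceTime) :
    shear ν q = (q.1 + (ν * q.2) • Pi.single 1 1, q.2) := rfl

lemma IsTest.comp_shear (h : IsTest φ) (ν : ℝ) : IsTest (φ ∘ shear ν) :=
  ⟨h.1.comp (shear ν).contDiff, h.2.comp_homeomorph (shear ν).toHomeomorph⟩

lemma IsTest.pdt_comp_shear (h : IsTest φ) (ν : ℝ) (q : SpaceTime) :
    pdt (φ ∘ shear ν) q = pdt φ (shear ν q) + ν * pdx 1 φ (shear ν q) := by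
  unfold pdt pdx
  rw [fderiv_comp q (h.differentiable _) (shear ν).differentiableAt,
    ContinuousLinearEquiv.fderiv, ContinuousLinearMap.comp_apply]
  have : ((shear ν : SpaceTime →L[ℝ] SpaceTime) (0, 1) : SpaceTime)
      = (0, 1) + ν • ((Pi.single 1 1, 0) : SpaceTime) := by
    ext i <;> simp [shear_apply]
  rw [this, map_add, map_smul, smul_eq_mul]

lemma IsTest.setIntegral_belowRay_pdt (h : IsTest φ) (ν : ℝ) :
    ∫ q in belowRay ν, pdt φ q
      = - (∫ x in {x : Fin 2 → ℝ | x 1 < 0}, φ (x, 0))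
        - ν * ∫ q in belowRay ν, pdx 1 φ q := by
  have hs := h.comp_shear ν
  have h1 : ∫ q in belowRay 0, pdt (φ ∘ shear ν) q
      = - ∫ x in {x : Fin 2 → ℝ | x 1 < 0}, φ (x, 0) := by
    have : belowRay 0 = {x : Fin 2 → ℝ | x 1 < 0} ×ˢ Ioi (0 : ℝ) := by
      ext q; simp [belowRay, and_comm]
    rw [this, hs.setIntegral_prod_pdt]
    simp [shear_apply]
  have hi : Integrable (fun q => pdt φ q + ν * pdx 1 φ q) :=
    h.integrable_pdt.add ((h.integrable_pdx 1).const_mul ν)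
  have h2 : ∫ q in belowRay ν, (pdt φ q + ν * pdx 1 φ q)
      = ∫ q in belowRay 0, pdt (φ ∘ shear ν) q := by
    rw [setIntegral_belowRay hi, setIntegral_belowRay hs.integrable_pdt]
    congr 1
    ext t
    have hm : ∀ c : ℝ, MeasurableSet {x : Fin 2 → ℝ | x 1 ∈ Iio c} := fun c =>
      measurable_pi_apply 1 measurableSet_Iio
    rw [← integral_indicator (hm _), ← integral_indicator (hm _),
      ← integral_add_right_eq_self _ ((ν * t) • (Pi.single 1 1 : Fin 2 → ℝ))]
    congr 1
    ext x
    have := h.pdt_comp_shear ν (x, t)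
    rw [shear_apply] at this
    simp [indicator, this]
  have h3 : ∫ q in belowRay ν, (pdt φ q + ν * pdx 1 φ q)
      = (∫ q in belowRay ν, pdt φ q) + ν * ∫ q in belowRay ν, pdx 1 φ q := by
    rw [integral_add h.integrable_pdt.integrableOn
      ((h.integrable_pdx 1).const_mul ν).integrableOn, integral_const_mul]
  linarith

lemma fanField_eq_sum {νm ν1 νp : ℝ} (h1 : νm < ν1) (h2 : ν1 < νp) (am a1 a2 ap : ℝ)
    {q : SpaceTime} (hq : q ∈ posTime) :
    fanField νm ν1 νp am a1 a2 ap q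
      = ap + (am - a1) * (belowRay νm).indicator 1 q + (a1 - a2) * (belowRay ν1).indicator 1 q
        + (a2 - ap) * (belowRay νp).indicator 1 q := by
  have ht : 0 < q.2 := hq
  have e1 : νm * q.2 < ν1 * q.2 := mul_lt_mul_of_pos_right h1 ht
  have e2 : ν1 * q.2 < νp * q.2 := mul_lt_mul_of_pos_right h2 ht
  unfold fanField
  split_ifs with c1 c2 c3
  · have c2 : q.1 1 < ν1 * q.2 := by linarith
    have c3 : q.1 1 < νp * q.2 := by linarith
    simp [indicator, belowRay, ht, c1, c2, c3]
    ring
  · have c3 : q.1 1 < νp * q.2 := by linarith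
    simp [indicator, belowRay, ht, c1, c2, c3]
    ring
  · simp [indicator, belowRay, ht, c1, c2, c3]
  · simp [indicator, belowRay, ht, c1, c2, c3]

lemma setIntegral_posTime_fanField_mul {νm ν1 νp : ℝ} (h1 : νm < ν1) (h2 : ν1 < νp)
    (am a1 a2 ap : ℝ) {g : SpaceTime → ℝ} (hg : Integrable g) :
    ∫ q in posTime, fanField νm ν1 νp am a1 a2 ap q * g q
      = ap * (∫ q in posTime, g q) + (am - a1) * (∫ q in belowRay νm, g q)
        + (a1 - a2) * (∫ q in belowRay ν1, g q) + (a2 - ap) * ∫ q in belowRay νp, g q := by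
  have hi : ∀ ν, Integrable ((belowRay ν).indicator g) (volume.restrict posTime) := fun ν =>
    (hg.indicator (measurableSet_belowRay ν)).integrableOn
  have hb : ∀ ν, ∫ q in belowRay ν, g q = ∫ q in posTime, (belowRay ν).indicator g q := by
    intro ν
    rw [setIntegral_indicator (measurableSet_belowRay ν),
      inter_eq_right.2 (show belowRay ν ⊆ posTime from fun q hq => hq.1)]
  rw [hb, hb, hb, ← integral_const_mul, ← integral_const_mul, ← integral_const_mul,
    ← integral_const_mul,
    ← integral_add' (hg.integrableOn.const_mul _) ((hi _).const_mul _),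
    ← integral_add' ((hg.integrableOn.const_mul _).add ((hi _).const_mul _)) ((hi _).const_mul _),
    ← integral_add' (((hg.integrableOn.const_mul _).add ((hi _).const_mul _)).add
      ((hi _).const_mul _)) ((hi _).const_mul _)]
  refine setIntegral_congr_fun measurableSet_posTime fun q hq => ?_
  have hc : ∀ ν, (belowRay ν).indicator g q = (belowRay ν).indicator 1 q * g q := by
    intro ν
    by_cases hν : q ∈ belowRay ν <;> simp [hν]
  simp only [fanField_eq_sum h1 h2 _ _ _ _ hq, hc, Pi.add_apply]
  ring

lemma integrableOn_fanField_mul {νm ν1 νp : ℝ} (am a1 a2 ap : ℝ) {g : SpaceTime → ℝ}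
    (hg : Integrable g) :
    IntegrableOn (fun q => fanField νm ν1 νp am a1 a2 ap q * g q) posTime := by
  have hm : Measurable (fanField νm ν1 νp am a1 a2 ap) := by
    have hr : ∀ ν : ℝ, MeasurableSet {q : SpaceTime | q.1 1 < ν * q.2} := fun ν =>
      measurableSet_lt (by fun_prop) (by fun_prop)
    unfold fanField
    exact Measurable.ite (hr _) measurable_const (Measurable.ite (hr _) measurable_const
      (Measurable.ite (hr _) measurable_const measurable_const))
  refine (hg.bdd_mul (c := |am| + |a1| + |a2| + |ap|) hm.aestronglyMeasurable
    (Filter.Eventually.of_forall fun q => ?_)).integrableOn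
  have := abs_nonneg am
  have := abs_nonneg a1
  have := abs_nonneg a2
  have := abs_nonneg ap
  unfold fanField
  split_ifs <;> rw [Real.norm_eq_abs] <;> linarith

/-- The weak divergence of a piecewise constant field on a fan partition is carried by the
initial plane and the three interfaces. -/
lemma IsTest.integral_fanField (h : IsTest φ) {νm ν1 νp : ℝ} (h1 : νm < ν1) (h2 : ν1 < νp)
    (am a1 a2 ap bm b1 b2 bp cm c1 c2 cp : ℝ) :
    ∫ q in posTime, (fanField νm ν1 νp am a1 a2 ap q * pdt φ q
        + (fanField νm ν1 νp cm c1 c2 cp q * pdx 0 φ q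
          + fanField νm ν1 νp bm b1 b2 bp q * pdx 1 φ q))
      = -(ap * (∫ x, φ (x, 0)) + (am - ap) * ∫ x in {x : Fin 2 → ℝ | x 1 < 0}, φ (x, 0))
        + ((bm - b1) - νm * (am - a1)) * (∫ q in belowRay νm, pdx 1 φ q)
        + ((b1 - b2) - ν1 * (a1 - a2)) * (∫ q in belowRay ν1, pdx 1 φ q)
        + ((b2 - bp) - νp * (a2 - ap)) * (∫ q in belowRay νp, pdx 1 φ q) := by
  have ht := h.integrable_pdt
  have hx := h.integrable_pdx
  have hs : IntegrableOn (fun q => fanField νm ν1 νp cm c1 c2 cp q * pdx 0 φ q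
      + fanField νm ν1 νp bm b1 b2 bp q * pdx 1 φ q) posTime :=
    (integrableOn_fanField_mul _ _ _ _ (hx 0)).add (integrableOn_fanField_mul _ _ _ _ (hx 1))
  rw [integral_add (integrableOn_fanField_mul _ _ _ _ ht) hs,
    integral_add (integrableOn_fanField_mul _ _ _ _ (hx 0))
      (integrableOn_fanField_mul _ _ _ _ (hx 1)),
    setIntegral_posTime_fanField_mul h1 h2 _ _ _ _ ht,
    setIntegral_posTime_fanField_mul h1 h2 _ _ _ _ (hx 0),
    setIntegral_posTime_fanField_mul h1 h2 _ _ _ _ (hx 1)]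
  simp only [h.setIntegral_belowRay_pdt, h.setIntegral_posTime_pdt, h.setIntegral_posTime_pdx,
    h.setIntegral_belowRay_pdx_zero]
  ring

lemma IsTest.integral_riemann (h : IsTest φ) (am ap : ℝ) :
    ∫ x : Fin 2 → ℝ, (if x 1 < 0 then am else ap) * φ (x, 0)
      = ap * (∫ x, φ (x, 0)) + (am - ap) * ∫ x in {x : Fin 2 → ℝ | x 1 < 0}, φ (x, 0) := by
  have hm : MeasurableSet {x : Fin 2 → ℝ | x 1 < 0} :=
    measurableSet_lt (by fun_prop) (by fun_prop)
  have hi := h.integrable_slice 0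
  rw [← integral_indicator hm, ← integral_const_mul, ← integral_const_mul,
    ← integral_add (hi.const_mul _) ((hi.indicator hm).const_mul _)]
  congr 1
  ext x
  by_cases hx : x 1 < 0 <;> simp [indicator, hx]
  ring

end Integrals

section Interfaces

/-- A macroscopic state `(ρ, v)` together with its Reynolds stress. -/
structure StressState where
  dens : ℝ
  vel₁ : ℝ
  vel₂ : ℝ
  str₁₁ : ℝ
  str₁₂ : ℝ
  str₂₂ : ℝ

/-- The state has positive density and positive definite Reynolds stress. -/
structure StressState.IsSubsolution (S : StressState) : Prop where
  dens_pos : 0 < S.dens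
  str₁₁_pos : 0 < S.str₁₁
  det_pos : S.str₁₂ ^ 2 < S.str₁₁ * S.str₂₂

lemma StressState.IsSubsolution.str₂₂_pos {S : StressState} (h : S.IsSubsolution) :
    0 < S.str₂₂ := by
  have h1 := h.str₁₁_pos
  have h2 := h.det_pos
  by_contra! hc
  nlinarith [sq_nonneg S.str₁₂]

/-- Total energy density. -/
def StressState.energy (ε : ℝ → ℝ) (S : StressState) : ℝ :=
  S.dens * ε S.dens + S.dens * (S.vel₁ ^ 2 + S.vel₂ ^ 2) / 2 + (S.str₁₁ + S.str₂₂) / 2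

/-- Rankine–Hugoniot conditions and energy inequality across an interface moving with speed `ν`
in the `x₂`-direction, the state `S` lying below and `S'` above. -/
structure StressState.Jump (p ε : ℝ → ℝ) (ν : ℝ) (S S' : StressState) : Prop where
  mass : S.dens * S.vel₂ - S'.dens * S'.vel₂ = ν * (S.dens - S'.dens)
  tangential : (S.dens * S.vel₁ * S.vel₂ + S.str₁₂) - (S'.dens * S'.vel₁ * S'.vel₂ + S'.str₁₂)
    = ν * (S.dens * S.vel₁ - S'.dens * S'.vel₁)
  normal : (S.dens * S.vel₂ ^ 2 + p S.dens + S.str₂₂)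
      - (S'.dens * S'.vel₂ ^ 2 + p S'.dens + S'.str₂₂)
    = ν * (S.dens * S.vel₂ - S'.dens * S'.vel₂)
  energy : 0 ≤ ((S.energy ε + p S.dens) * S.vel₂ - (S'.energy ε + p S'.dens) * S'.vel₂)
    - ν * (S.energy ε - S'.energy ε)

/-- The constant `C` of the subsolution attached to a state. -/
def StressState.energyConst (S : StressState) : ℝ :=
  S.vel₁ ^ 2 + S.vel₂ ^ 2 + (S.str₁₁ + S.str₂₂) / S.dens

/-- The trace-free matrix `u` of the subsolution attached to a state. -/
def StressState.traceFree (S : StressState) : Matrix (Fin 2) (Fin 2) ℝ :=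
  !![S.vel₁ ^ 2 + S.str₁₁ / S.dens - S.energyConst / 2, S.vel₁ * S.vel₂ + S.str₁₂ / S.dens;
    S.vel₁ * S.vel₂ + S.str₁₂ / S.dens, S.vel₂ ^ 2 + S.str₂₂ / S.dens - S.energyConst / 2]

lemma StressState.isS0_traceFree (S : StressState) : IsS0 S.traceFree := by
  constructor
  · ext i j
    fin_cases i <;> fin_cases j <;> simp [traceFree]
  · simp [traceFree, Matrix.trace_fin_two, energyConst]
    ring

lemma StressState.IsSubsolution.energyConst_pos {S : StressState} (h : S.IsSubsolution) :
    0 < S.energyConst := by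
  have h1 := h.str₁₁_pos
  have h2 := h.str₂₂_pos
  have h3 := h.dens_pos
  unfold energyConst
  positivity

lemma StressState.IsSubsolution.posDef {S : StressState} (h : S.IsSubsolution) :
    ((S.energyConst / 2) • (1 : Matrix (Fin 2) (Fin 2) ℝ) - outer ![S.vel₁, S.vel₂]
      + S.traceFree).PosDef := by
  have h3 := h.dens_pos
  have h1 := h.str₁₁_pos
  have h2 := h.det_pos
  have he : (S.energyConst / 2) • (1 : Matrix (Fin 2) (Fin 2) ℝ) - outer ![S.vel₁, S.vel₂]
      + S.traceFree
      = !![S.str₁₁ / S.dens, S.str₁₂ / S.dens; S.str₁₂ / S.dens, S.str₂₂ / S.dens] := by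
    ext i j
    fin_cases i <;> fin_cases j <;> simp [traceFree, outer, vecMulVec] <;> ring
  rw [he]
  refine Matrix.PosDef.of_dotProduct_mulVec_pos ?_ fun x hx => ?_
  · ext i j
    fin_cases i <;> fin_cases j <;> simp
  · simp only [dotProduct, mulVec, Fin.sum_univ_two, Pi.star_apply, star_trivial, of_apply,
      cons_val_zero, cons_val_one]
    have hq : x 0 * (S.str₁₁ / S.dens * x 0 + S.str₁₂ / S.dens * x 1)
        + x 1 * (S.str₁₂ / S.dens * x 0 + S.str₂₂ / S.dens * x 1)
        = ((S.str₁₁ * x 0 + S.str₁₂ * x 1) ^ 2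
          + (S.str₁₁ * S.str₂₂ - S.str₁₂ ^ 2) * x 1 ^ 2) / (S.str₁₁ * S.dens) := by
      field_simp
      ring
    rw [hq]
    refine div_pos ?_ (by positivity)
    by_cases h0 : x 1 = 0
    · have : x 0 ≠ 0 := fun h00 => hx (by ext i; fin_cases i <;> simp [h0, h00])
      simp only [h0]
      ring_nf
      positivity
    · have : 0 < x 1 ^ 2 := by positivity
      nlinarith [sq_nonneg (S.str₁₁ * x 0 + S.str₁₂ * x 1)]

lemma IsTest.fanField_weak {φ : SpaceTime → ℝ} (h : IsTest φ) {νm ν1 νp : ℝ} (h1 : νm < ν1)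
    (h2 : ν1 < νp) {am a1 a2 ap bm b1 b2 bp : ℝ} (cm c1 c2 cp : ℝ)
    (em : bm - b1 = νm * (am - a1)) (e1 : b1 - b2 = ν1 * (a1 - a2))
    (ep : b2 - bp = νp * (a2 - ap)) :
    (∫ q in posTime, (fanField νm ν1 νp am a1 a2 ap q * pdt φ q
        + (fanField νm ν1 νp cm c1 c2 cp q * pdx 0 φ q
          + fanField νm ν1 νp bm b1 b2 bp q * pdx 1 φ q)))
      + ∫ x : Fin 2 → ℝ, (if x 1 < 0 then am else ap) * φ (x, 0) = 0 := by
  rw [h.integral_fanField h1 h2, h.integral_riemann, em, e1, ep]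
  ring

variable {p ε : ℝ → ℝ} {νm ν1 νp : ℝ} {S₁ S₂ : StressState}
  {ρm ρp vm1 vm2 vp1 vp2 : ℝ}

open StressState in
lemma isFanSubsolution_of_jump (h1 : νm < ν1) (h2 : ν1 < νp) (hS₁ : S₁.IsSubsolution)
    (hS₂ : S₂.IsSubsolution) (jm : Jump p ε νm ⟨ρm, vm1, vm2, 0, 0, 0⟩ S₁)
    (j1 : Jump p ε ν1 S₁ S₂) (jp : Jump p ε νp S₂ ⟨ρp, vp1, vp2, 0, 0, 0⟩) :
    IsFanSubsolution p ρm ρp ![vm1, vm2] ![vp1, vp2] νm ν1 νp S₁.dens S₂.dens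
      ![S₁.vel₁, S₁.vel₂] ![S₂.vel₁, S₂.vel₂] S₁.traceFree S₂.traceFree
      S₁.energyConst S₂.energyConst := by
  have d1 := hS₁.dens_pos.ne'
  have d2 := hS₂.dens_pos.ne'
  refine ⟨h1, h2, hS₁.dens_pos, hS₂.dens_pos, S₁.isS0_traceFree, S₂.isS0_traceFree,
    hS₁.energyConst_pos, hS₂.energyConst_pos, hS₁.posDef, hS₂.posDef, fun φ hφ => ?_,
    fun j φ hφ => ?_⟩
  · have := hφ.fanField_weak h1 h2 (ρm * vm1) (S₁.dens * S₁.vel₁) (S₂.dens * S₂.vel₁) (ρp * vp1)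
      jm.mass j1.mass jp.mass
    simpa [Fin.sum_univ_two, riemannRho] using this
  · fin_cases j
    · have := hφ.fanField_weak h1 h2 (ρm * vm1 ^ 2 + p ρm)
        (S₁.dens * S₁.vel₁ ^ 2 + S₁.str₁₁ + p S₁.dens)
        (S₂.dens * S₂.vel₁ ^ 2 + S₂.str₁₁ + p S₂.dens) (ρp * vp1 ^ 2 + p ρp)
        jm.tangential j1.tangential jp.tangential
      refine Eq.trans ?_ this
      congr 1
      · refine setIntegral_congr_fun measurableSet_posTime fun q _ => ?_
        simp only [fanField]
        split_ifs <;>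
          simp [Fin.sum_univ_two, uPM, outer, vecMulVec, sq2, traceFree] <;> field_simp <;> ring
      · congr 1
        ext x
        simp only [riemannRho, riemannV]
        split_ifs <;> simp
    · have := hφ.fanField_weak h1 h2 (ρm * vm1 * vm2) (S₁.dens * S₁.vel₁ * S₁.vel₂ + S₁.str₁₂)
        (S₂.dens * S₂.vel₁ * S₂.vel₂ + S₂.str₁₂) (ρp * vp1 * vp2)
        jm.normal j1.normal jp.normal
      refine Eq.trans ?_ this
      congr 1
      · refine setIntegral_congr_fun measurableSet_posTime fun q _ => ?_
        simp only [fanField]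
        split_ifs <;>
          simp [Fin.sum_univ_two, uPM, outer, vecMulVec, sq2, traceFree] <;> field_simp <;> ring
      · congr 1
        ext x
        simp only [riemannRho, riemannV]
        split_ifs <;> simp

open StressState in
lemma isAdmissibleFanSubsolution_of_jump (h1 : νm < ν1) (h2 : ν1 < νp) (hS₁ : S₁.IsSubsolution)
    (hS₂ : S₂.IsSubsolution) (jm : Jump p ε νm ⟨ρm, vm1, vm2, 0, 0, 0⟩ S₁)
    (j1 : Jump p ε ν1 S₁ S₂) (jp : Jump p ε νp S₂ ⟨ρp, vp1, vp2, 0, 0, 0⟩) :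
    IsAdmissibleFanSubsolution p ε ρm ρp ![vm1, vm2] ![vp1, vp2] νm ν1 νp S₁.dens S₂.dens
      ![S₁.vel₁, S₁.vel₂] ![S₂.vel₁, S₂.vel₂] S₁.traceFree S₂.traceFree
      S₁.energyConst S₂.energyConst := by
  refine ⟨isFanSubsolution_of_jump h1 h2 hS₁ hS₂ jm j1 jp, fun φ hφ h0 hsupp => ?_⟩
  have d1 := hS₁.dens_pos.ne'
  have d2 := hS₂.dens_pos.ne'
  have hz : ∀ x : Fin 2 → ℝ, φ (x, 0) = 0 := fun x =>
    image_eq_zero_of_notMem_tsupport fun hx => by simpa [posTime] using hsupp hx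
  set Sm : StressState := ⟨ρm, vm1, vm2, 0, 0, 0⟩ with hSm
  set Sp : StressState := ⟨ρp, vp1, vp2, 0, 0, 0⟩ with hSp
  have key := hφ.integral_fanField h1 h2 (Sm.energy ε) (S₁.energy ε) (S₂.energy ε) (Sp.energy ε)
    ((Sm.energy ε + p Sm.dens) * Sm.vel₂) ((S₁.energy ε + p S₁.dens) * S₁.vel₂)
    ((S₂.energy ε + p S₂.dens) * S₂.vel₂) ((Sp.energy ε + p Sp.dens) * Sp.vel₂)
    ((Sm.energy ε + p Sm.dens) * Sm.vel₁) ((S₁.energy ε + p S₁.dens) * S₁.vel₁)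
    ((S₂.energy ε + p S₂.dens) * S₂.vel₁) ((Sp.energy ε + p Sp.dens) * Sp.vel₁)
  simp only [hz, integral_zero, mul_zero, add_zero, neg_zero, zero_add] at key
  have hle : 0 ≤ ∫ q in posTime, (fanField νm ν1 νp (Sm.energy ε) (S₁.energy ε) (S₂.energy ε)
        (Sp.energy ε) q * pdt φ q
      + (fanField νm ν1 νp ((Sm.energy ε + p Sm.dens) * Sm.vel₁)
          ((S₁.energy ε + p S₁.dens) * S₁.vel₁) ((S₂.energy ε + p S₂.dens) * S₂.vel₁)
          ((Sp.energy ε + p Sp.dens) * Sp.vel₁) q * pdx 0 φ q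
        + fanField νm ν1 νp ((Sm.energy ε + p Sm.dens) * Sm.vel₂)
          ((S₁.energy ε + p S₁.dens) * S₁.vel₂) ((S₂.energy ε + p S₂.dens) * S₂.vel₂)
          ((Sp.energy ε + p Sp.dens) * Sp.vel₂) q * pdx 1 φ q)) := by
    rw [key]
    have i := hφ.setIntegral_belowRay_pdx_one_nonneg h0
    exact add_nonneg (add_nonneg (mul_nonneg jm.energy (i _)) (mul_nonneg j1.energy (i _)))
      (mul_nonneg jp.energy (i _))
  refine hle.trans_eq (setIntegral_congr_fun measurableSet_posTime fun q _ => ?_)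
  simp only [fanEnergy, fanField, hSm, hSp]
  split_ifs <;>
    simp [Fin.sum_univ_two, sq2, StressState.energy, energyConst] <;> field_simp <;> ring

end Interfaces

section FanConstruction

open StressState

variable {p ε : ℝ → ℝ}

/-- Two intermediate subsolution states connecting two given states by admissible interfaces. -/
def HasSubsolutionFan (p ε : ℝ → ℝ) (S S' : StressState) : Prop :=
  ∃ (νm ν1 νp : ℝ) (S₁ S₂ : StressState), νm < ν1 ∧ ν1 < νp ∧ S₁.IsSubsolution ∧
    S₂.IsSubsolution ∧ Jump p ε νm S S₁ ∧ Jump p ε ν1 S₁ S₂ ∧ Jump p ε νp S₂ S'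

/-- Reflection of a state under `x₂ ↦ -x₂`. -/
def StressState.reflect (S : StressState) : StressState :=
  ⟨S.dens, S.vel₁, -S.vel₂, S.str₁₁, -S.str₁₂, S.str₂₂⟩

lemma StressState.IsSubsolution.reflect {S : StressState} (h : S.IsSubsolution) :
    S.reflect.IsSubsolution :=
  ⟨h.dens_pos, h.str₁₁_pos, by simpa [StressState.reflect] using h.det_pos⟩

lemma StressState.Jump.reflect {ν : ℝ} {S S' : StressState} (h : Jump p ε ν S S') :
    Jump p ε (-ν) S'.reflect S.reflect := by
  obtain ⟨h1, h2, h3, h4⟩ := h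
  unfold StressState.energy at h4
  constructor <;> simp only [StressState.reflect, StressState.energy] <;> linarith

lemma HasSubsolutionFan.reflect {S S' : StressState} (h : HasSubsolutionFan p ε S S') :
    HasSubsolutionFan p ε S'.reflect S.reflect := by
  obtain ⟨νm, ν1, νp, S₁, S₂, h1, h2, hS₁, hS₂, jm, j1, jp⟩ := h
  exact ⟨-νp, -ν1, -νm, S₂.reflect, S₁.reflect, neg_lt_neg h2, neg_lt_neg h1, hS₂.reflect,
    hS₁.reflect, jp.reflect, j1.reflect, jm.reflect⟩

/-- Interface conditions in terms of the mass flux `k` and the specific volumes `τ`, `τ'`. -/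
lemma StressState.Jump.of_massFlux {ν k τ τ' v v' y y' r₁₁ r₁₂ r₂₂ r₁₁' r₁₂' r₂₂' : ℝ}
    (hτ : 0 < τ) (hτ' : 0 < τ') (hv : v = ν + k * τ) (hv' : v' = ν + k * τ')
    (hP : p τ⁻¹ + r₂₂ + k ^ 2 * τ = p τ'⁻¹ + r₂₂' + k ^ 2 * τ')
    (ht : k * y + r₁₂ = k * y' + r₁₂')
    (hE : r₂₂ * v - r₂₂' * v' ≤ k * (ε τ⁻¹ - ε τ'⁻¹
      + (p τ⁻¹ + r₂₂ + (p τ'⁻¹ + r₂₂')) * (τ - τ') / 2 + (y ^ 2 - y' ^ 2) / 2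
      + ((r₁₁ + r₂₂) * τ - (r₁₁' + r₂₂') * τ') / 2)) :
    Jump p ε ν ⟨τ⁻¹, y, v, r₁₁, r₁₂, r₂₂⟩ ⟨τ'⁻¹, y', v', r₁₁', r₁₂', r₂₂'⟩ := by
  have hd : τ⁻¹ * v = ν * τ⁻¹ + k := by rw [hv]; field_simp
  have hd' : τ'⁻¹ * v' = ν * τ'⁻¹ + k := by rw [hv']; field_simp
  have hn : p τ⁻¹ + r₂₂ + k * v = p τ'⁻¹ + r₂₂' + k * v' := by rw [hv, hv']; linarith
  constructor
  · simp only
    linarith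
  · simp only
    linear_combination y * hd - y' * hd' + ht
  · simp only
    linear_combination v * hd - v' * hd' + hn
  · have h1 : ∀ {σ u c s : ℝ}, 0 < σ → u = ν + k * σ →
        (σ⁻¹ * ε σ⁻¹ + σ⁻¹ * (c ^ 2 + u ^ 2) / 2 + s / 2) * (u - ν)
          = k * (ε σ⁻¹ + (c ^ 2 + u ^ 2) / 2 + s * σ / 2) := by
      intro σ u c s hσ hu
      rw [show u - ν = k * σ by linarith]
      field_simp
    have e1 := h1 (c := y) (s := r₁₁ + r₂₂) hτ hv
    have e2 := h1 (c := y') (s := r₁₁' + r₂₂') hτ' hv'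
    have h3 : (p τ⁻¹ + r₂₂) * v - (p τ'⁻¹ + r₂₂') * v' + k * (v ^ 2 - v' ^ 2) / 2
        = k * (p τ⁻¹ + r₂₂ + (p τ'⁻¹ + r₂₂')) * (τ - τ') / 2 := by
      have h4 : v - v' = k * (τ - τ') := by rw [hv, hv']; ring
      linear_combination (v + v') / 2 * hn + (p τ⁻¹ + r₂₂ + (p τ'⁻¹ + r₂₂')) / 2 * h4
    simp only [StressState.energy]
    linarith

/-- Assembly of a fan from the mass fluxes `j`, `k`, `-g` through its three interfaces. -/
lemma hasSubsolutionFan_of_massFlux {a x A B k j g w V y z u d₁ d₂ r₁ r₂ : ℝ} (ha : 0 < a)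
    (hx : 0 < x) (hA : 0 < A) (hB : 0 < B) (hkj : k < j) (hkg : 0 < k + g)
    (hV : k * B + j * A = V + g * x) (hu : k * y = k * u + g * (u - z))
    (hr₂ : p (a + x)⁻¹ + r₂ = p a⁻¹ - g ^ 2 * x)
    (hr₁ : p (a + x + B)⁻¹ + r₁ = p a⁻¹ - g ^ 2 * x - k ^ 2 * B)
    (hb : p (a + x + B + A)⁻¹ = p a⁻¹ - g ^ 2 * x - k ^ 2 * B - j ^ 2 * A)
    (hd₁ : 0 < d₁) (hd₂ : 0 < d₂) (hr₁_pos : 0 < r₁)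
    (hdet : (g * (u - z)) ^ 2 < d₂ / (a + x) * r₂)
    (hL : 0 ≤ j * (ε (a + x + B + A)⁻¹ - ε (a + x + B)⁻¹
      + (p (a + x + B + A)⁻¹ + (p (a + x + B)⁻¹ + r₁)) * A / 2
      - (d₁ + r₁ * (a + x + B)) / 2) + r₁ * (w - g * x + k * B))
    (hM : 0 ≤ k * (ε (a + x + B)⁻¹ - ε (a + x)⁻¹
      + (p (a + x + B)⁻¹ + r₁ + (p (a + x)⁻¹ + r₂)) * B / 2
      + (y ^ 2 - u ^ 2 + (d₁ + r₁ * (a + x + B)) - (d₂ + r₂ * (a + x))) / 2)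
      - r₁ * (w - g * x + k * B) + r₂ * (w - g * x))
    (hR : r₂ * (w - g * x) ≤ -g * (ε (a + x)⁻¹ - ε a⁻¹ + (p (a + x)⁻¹ + r₂ + p a⁻¹) * x / 2
      + (u ^ 2 - z ^ 2) / 2 + (d₂ + r₂ * (a + x)) / 2)) :
    HasSubsolutionFan p ε ⟨(a + x + B + A)⁻¹, y, w + V, 0, 0, 0⟩ ⟨a⁻¹, z, w, 0, 0, 0⟩ := by
  have h2 : 0 < a + x := by positivity
  have h1 : 0 < a + x + B := by positivity
  have h0 : 0 < a + x + B + A := by positivity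
  refine ⟨w - g * x + k * B - j * (a + x + B), w - g * x - k * (a + x), w + g * a,
    ⟨(a + x + B)⁻¹, y, w - g * x + k * B, d₁ / (a + x + B), 0, r₁⟩,
    ⟨(a + x)⁻¹, u, w - g * x, d₂ / (a + x), g * (u - z), r₂⟩, ?_, ?_,
    ⟨inv_pos.2 h1, div_pos hd₁ h1, ?_⟩, ⟨inv_pos.2 h2, div_pos hd₂ h2, hdet⟩,
    .of_massFlux (k := j) h0 h1 ?_ ?_ ?_ ?_ ?_, .of_massFlux (k := k) h1 h2 ?_ ?_ ?_ ?_ ?_,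
    .of_massFlux (k := -g) h2 ha ?_ ?_ ?_ ?_ ?_⟩
  · nlinarith
  · nlinarith
  · have := mul_pos (div_pos hd₁ h1) hr₁_pos
    simpa using this
  · linarith
  · ring
  · linarith
  · ring
  · have : d₁ / (a + x + B) * (a + x + B) = d₁ := by field_simp
    linear_combination hL + j / 2 * this
  · ring
  · ring
  · linarith
  · linarith
  · have e1 : d₁ / (a + x + B) * (a + x + B) = d₁ := by field_simp
    have e2 : d₂ / (a + x) * (a + x) = d₂ := by field_simp
    linear_combination hM - k / 2 * e1 + k / 2 * e2
  · ring
  · ring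
  · linarith
  · ring
  · have e2 : d₂ / (a + x) * (a + x) = d₂ := by field_simp
    linear_combination hR + g / 2 * e2

end FanConstruction

section FluxSplitting

/-- Excess of the pressure jump `P` over the one of a single shock with velocity jump `W` and
specific volume jump `T`, per unit of specific volume. -/
def fluxExcess (W T P : ℝ) : ℝ := P / T - (W / T) ^ 2

/-- Mass flux of the faster of two shocks replacing a single one. -/
def fastFlux (W T P : ℝ) : ℝ := W / T + 2 * fluxExcess W T P / (W / T)

/-- Specific volume jump across the slower of the two shocks; its mass flux is `W / T / 2`. -/
def slowWidth (W T P : ℝ) : ℝ :=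
  4 * fluxExcess W T P / ((W / T) ^ 2 + 4 * fluxExcess W T P) * T

variable {W T P : ℝ}

lemma slowWidth_pos (hT : 0 < T) (hs : 0 < fluxExcess W T P) :
    0 < slowWidth W T P := by
  unfold slowWidth
  positivity

lemma slowWidth_lt (hW : 0 < W) (hT : 0 < T) (hs : 0 < fluxExcess W T P) :
    slowWidth W T P < T := by
  unfold slowWidth
  have : 4 * fluxExcess W T P / ((W / T) ^ 2 + 4 * fluxExcess W T P) < 1 := by
    rw [div_lt_one (by positivity)]
    have : 0 < (W / T) ^ 2 := by positivity
    linarith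
  nlinarith

lemma slowFlux_lt_fastFlux (hW : 0 < W) (hT : 0 < T) (hs : 0 < fluxExcess W T P) :
    W / T / 2 < fastFlux W T P := by
  unfold fastFlux
  have h1 : 0 < W / T := by positivity
  have h2 : 0 < 2 * fluxExcess W T P / (W / T) := by positivity
  linarith

lemma velocity_split (hW : 0 < W) (hT : 0 < T) (hs : 0 < fluxExcess W T P) :
    W / T / 2 * slowWidth W T P + fastFlux W T P * (T - slowWidth W T P) = W := by
  unfold slowWidth fastFlux
  generalize fluxExcess W T P = s at *
  have h1 : 0 < W / T := by positivity
  have h2 : W / T * T = W := by field_simp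
  generalize W / T = μ at *
  rw [← h2]
  field_simp
  ring

lemma pressure_split (hW : 0 < W) (hT : 0 < T) (hs : 0 < fluxExcess W T P) :
    (W / T / 2) ^ 2 * slowWidth W T P + fastFlux W T P ^ 2 * (T - slowWidth W T P) = P := by
  have h3 : P = ((W / T) ^ 2 + fluxExcess W T P) * T := by
    unfold fluxExcess
    field_simp
    ring
  conv_rhs => rw [h3]
  clear h3
  unfold slowWidth fastFlux
  generalize fluxExcess W T P = s at *
  have h1 : 0 < W / T := by positivity
  generalize W / T = μ at *
  field_simp
  ring

lemma slowFlux_sq_mul_lt (hW : 0 < W) (hT : 0 < T) (hs : 0 < fluxExcess W T P) :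
    (W / T / 2) ^ 2 * T < P := by
  have h1 : P = ((W / T) ^ 2 + fluxExcess W T P) * T := by
    unfold fluxExcess
    field_simp
    ring
  have h2 := mul_pos hs hT
  have h3 : 0 < (W / T) ^ 2 * T := by positivity
  linarith

lemma fluxExcess_eq_zero (hT : T ≠ 0) (h : W ^ 2 = P * T) : fluxExcess W T P = 0 := by
  unfold fluxExcess
  field_simp
  linarith

lemma fluxExcess_pos (hT : 0 < T) (h : W ^ 2 < P * T) : 0 < fluxExcess W T P := by
  have : fluxExcess W T P = (P * T - W ^ 2) / T ^ 2 := by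
    unfold fluxExcess
    field_simp
  rw [this]
  have : 0 < P * T - W ^ 2 := by linarith
  positivity

/-- Energy margin at the left interface. -/
def leftMargin (e f : ℝ → ℝ) (b d W T P q τ v : ℝ) : ℝ :=
  let k := W / T / 2
  let j := fastFlux W T P
  let B := slowWidth W T P
  let r := q - k ^ 2 * B - f (τ + B)
  j * (e b - e (τ + B) + (f b + (q - k ^ 2 * B)) * (T - B) / 2 - (d + r * (τ + B)) / 2)
    + r * (v + k * B)

/-- Energy margin at the middle interface. -/
def midMargin (e f : ℝ → ℝ) (d d' W T P q τ v h : ℝ) : ℝ :=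
  let k := W / T / 2
  let B := slowWidth W T P
  let r := q - k ^ 2 * B - f (τ + B)
  k * (e (τ + B) - e τ + (q - k ^ 2 * B + q) * B / 2
    + (h + (d + r * (τ + B)) - (d' + (q - f τ) * τ)) / 2) - r * (v + k * B) + (q - f τ) * v

variable {ι : Type*} [TopologicalSpace ι] {W T P q τ v h : ι → ℝ} {i₀ : ι} {e f : ℝ → ℝ}

lemma continuousAt_fluxExcess (hW : ContinuousAt W i₀) (hT : ContinuousAt T i₀)
    (hP : ContinuousAt P i₀) (hT0 : T i₀ ≠ 0) :
    ContinuousAt (fun i => fluxExcess (W i) (T i) (P i)) i₀ :=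
  (hP.div hT hT0).sub ((hW.div hT hT0).pow 2)

lemma continuousAt_fastFlux (hW : ContinuousAt W i₀) (hT : ContinuousAt T i₀)
    (hP : ContinuousAt P i₀) (hT0 : T i₀ ≠ 0) (hW0 : W i₀ ≠ 0) :
    ContinuousAt (fun i => fastFlux (W i) (T i) (P i)) i₀ :=
  (hW.div hT hT0).add
    ((continuousAt_const.mul (continuousAt_fluxExcess hW hT hP hT0)).div (hW.div hT hT0)
    (div_ne_zero hW0 hT0))

lemma continuousAt_slowWidth (hW : ContinuousAt W i₀) (hT : ContinuousAt T i₀)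
    (hP : ContinuousAt P i₀) (hT0 : T i₀ ≠ 0) (hW0 : W i₀ ≠ 0)
    (hs : 0 ≤ fluxExcess (W i₀) (T i₀) (P i₀)) :
    ContinuousAt (fun i => slowWidth (W i) (T i) (P i)) i₀ := by
  have h1 := continuousAt_const (y := (4 : ℝ)).mul (continuousAt_fluxExcess hW hT hP hT0)
  have h2 : 0 < (W i₀ / T i₀) ^ 2 := by positivity
  have h3 : 0 < (W i₀ / T i₀) ^ 2 + 4 * fluxExcess (W i₀) (T i₀) (P i₀) := by linarith
  exact (h1.div (((hW.div hT hT0).pow 2).add h1) h3.ne').mul hT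

lemma continuousAt_leftMargin (b d : ℝ) (he : ∀ t, 0 < t → ContinuousAt e t)
    (hf : ∀ t, 0 < t → ContinuousAt f t) (hW : ContinuousAt W i₀) (hT : ContinuousAt T i₀)
    (hP : ContinuousAt P i₀) (hq : ContinuousAt q i₀) (hτ : ContinuousAt τ i₀)
    (hv : ContinuousAt v i₀) (hT0 : 0 < T i₀) (hW0 : 0 < W i₀) (hτ0 : 0 < τ i₀)
    (hs : 0 ≤ fluxExcess (W i₀) (T i₀) (P i₀)) :
    ContinuousAt (fun i => leftMargin e f b d (W i) (T i) (P i) (q i) (τ i) (v i)) i₀ := by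
  have hj := continuousAt_fastFlux hW hT hP hT0.ne' hW0.ne'
  have hB := continuousAt_slowWidth hW hT hP hT0.ne' hW0.ne' hs
  have hk := (hW.div hT hT0.ne').div_const 2
  have hB0 : 0 ≤ slowWidth (W i₀) (T i₀) (P i₀) := by
    unfold slowWidth
    positivity
  have hE := (he _ (add_pos_of_pos_of_nonneg hτ0 hB0)).comp
    (f := fun i => τ i + slowWidth (W i) (T i) (P i))
     (hτ.add hB)
  have hF := (hf _ (add_pos_of_pos_of_nonneg hτ0 hB0)).comp
    (f := fun i => τ i + slowWidth (W i) (T i) (P i))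
     (hτ.add hB)
  have hr := (hq.sub ((hk.pow 2).mul hB)).sub hF
  exact (hj.mul (((continuousAt_const.sub hE).add (((continuousAt_const.add
    (hq.sub ((hk.pow 2).mul hB))).mul (hT.sub hB)).div_const 2)).sub
    ((continuousAt_const.add (hr.mul (hτ.add hB))).div_const 2))).add
    (hr.mul (hv.add (hk.mul hB)))

lemma continuousAt_midMargin (d d' : ℝ) (he : ∀ t, 0 < t → ContinuousAt e t)
    (hf : ∀ t, 0 < t → ContinuousAt f t) (hW : ContinuousAt W i₀) (hT : ContinuousAt T i₀)
    (hP : ContinuousAt P i₀) (hq : ContinuousAt q i₀) (hτ : ContinuousAt τ i₀)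
    (hv : ContinuousAt v i₀) (hh : ContinuousAt h i₀) (hT0 : 0 < T i₀) (hW0 : 0 < W i₀)
    (hτ0 : 0 < τ i₀) (hs : 0 ≤ fluxExcess (W i₀) (T i₀) (P i₀)) :
    ContinuousAt (fun i => midMargin e f d d' (W i) (T i) (P i) (q i) (τ i) (v i) (h i)) i₀ := by
  have hB := continuousAt_slowWidth hW hT hP hT0.ne' hW0.ne' hs
  have hk := (hW.div hT hT0.ne').div_const 2
  have hB0 : 0 ≤ slowWidth (W i₀) (T i₀) (P i₀) := by
    unfold slowWidth
    positivity
  have hE := (he _ (add_pos_of_pos_of_nonneg hτ0 hB0)).comp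
    (f := fun i => τ i + slowWidth (W i) (T i) (P i))
     (hτ.add hB)
  have hF := (hf _ (add_pos_of_pos_of_nonneg hτ0 hB0)).comp
    (f := fun i => τ i + slowWidth (W i) (T i) (P i))
     (hτ.add hB)
  have hE' := (he _ hτ0).comp hτ
  have hF' := (hf _ hτ0).comp hτ
  have hr := (hq.sub ((hk.pow 2).mul hB)).sub hF
  have hq' := hq.sub ((hk.pow 2).mul hB)
  exact ((hk.mul (((hE.sub hE').add (((hq'.add hq).mul hB).div_const 2)).add
    (((hh.add (continuousAt_const.add (hr.mul (hτ.add hB)))).sub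
      (continuousAt_const.add ((hq.sub hF').mul hτ))).div_const 2))).sub
    (hr.mul (hv.add (hk.mul hB)))).add ((hq.sub hF').mul hv)

end FluxSplitting

section ShockPerturbation

variable {e f : ℝ → ℝ} {a b : ℝ}

lemma exists_margins_pos (ha : 0 < a) (hab : a < b) (hfab : f b < f a)
    (he : ∀ t, 0 < t → ContinuousAt e t) (hf : ∀ t, 0 < t → ContinuousAt f t) {D : ℝ}
    (hD : 0 < D) (hDef : D = 2 * (e b - e a) + (f a + f b) * (b - a)) {w : ℝ → ℝ}
    (hw : Continuous w) :
    ∃ V₀ < √((f a - f b) * (b - a)), ∀ V, V₀ < V → V < √((f a - f b) * (b - a)) →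
      0 < V ∧ 0 < fluxExcess V (b - a) (f a - f b) ∧
      0 < leftMargin e f b (D / 2) V (b - a) (f a - f b) (f a) a (w V) ∧
      0 < midMargin e f (D / 2) (D / 4) V (b - a) (f a - f b) (f a) a (w V) 0 ∧
      0 < midMargin e f (D / 2) (D / 8) V (b - a) (f a - f b) (f a) a (w V) 0 := by
  set Vc := √((f a - f b) * (b - a)) with hVc
  have hT : 0 < b - a := by linarith
  have hP : 0 < f a - f b := by linarith
  have hVc0 : 0 < Vc := by positivity
  have hVc2 : Vc ^ 2 = (f a - f b) * (b - a) := Real.sq_sqrt (by positivity)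
  have hs : fluxExcess Vc (b - a) (f a - f b) = 0 := fluxExcess_eq_zero hT.ne' hVc2
  have hB : slowWidth Vc (b - a) (f a - f b) = 0 := by simp [slowWidth, hs]
  have hj : fastFlux Vc (b - a) (f a - f b) = Vc / (b - a) := by simp [fastFlux, hs]
  have hμ : 0 < Vc / (b - a) := by positivity
  have cL := continuousAt_leftMargin (W := fun V => V) (T := fun _ => b - a)
    (P := fun _ => f a - f b) (q := fun _ => f a) (τ := fun _ => a) (v := w) (i₀ := Vc) b (D / 2)
    he hf continuousAt_id continuousAt_const continuousAt_const continuousAt_const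
    continuousAt_const hw.continuousAt hT hVc0 ha hs.ge
  have cM := fun d' => continuousAt_midMargin (W := fun V => V) (T := fun _ => b - a)
    (P := fun _ => f a - f b) (q := fun _ => f a) (τ := fun _ => a) (v := w) (h := fun _ => 0)
    (i₀ := Vc) (D / 2) d' he hf continuousAt_id continuousAt_const continuousAt_const
    continuousAt_const continuousAt_const hw.continuousAt continuousAt_const hT hVc0 ha hs.ge
  have pL : 0 < leftMargin e f b (D / 2) Vc (b - a) (f a - f b) (f a) a (w Vc) := by
    simp only [leftMargin, hB, hj]
    have : 0 < Vc / (b - a) * (D / 4) := by positivity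
    convert this using 1
    rw [hDef]
    ring_nf
  have pM : ∀ d' < D / 2,
      0 < midMargin e f (D / 2) d' Vc (b - a) (f a - f b) (f a) a (w Vc) 0 := by
    intro d' hd'
    simp only [midMargin, hB]
    have h1 : 0 < D / 2 - d' := by linarith
    have : 0 < Vc / (b - a) * (D / 2 - d') / 4 := by positivity
    convert this using 1
    ring_nf
  have ev : ∀ᶠ V in nhds Vc, 0 < V ∧
      0 < leftMargin e f b (D / 2) V (b - a) (f a - f b) (f a) a (w V) ∧
      0 < midMargin e f (D / 2) (D / 4) V (b - a) (f a - f b) (f a) a (w V) 0 ∧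
      0 < midMargin e f (D / 2) (D / 8) V (b - a) (f a - f b) (f a) a (w V) 0 :=
    (lt_mem_nhds hVc0).and ((cL.eventually_const_lt pL).and
      (((cM _).eventually_const_lt (pM _ (by linarith))).and
        ((cM _).eventually_const_lt (pM _ (by linarith)))))
  obtain ⟨V₀, hV₀, h⟩ := (mem_nhdsLT_iff_exists_Ioo_subset (a := Vc)).1
    (nhdsWithin_le_nhds ev)
  refine ⟨V₀, hV₀, fun V h1 h2 => ?_⟩
  obtain ⟨h3, h4⟩ := h ⟨h1, h2⟩
  refine ⟨h3, fluxExcess_pos hT ?_, h4⟩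
  rw [← hVc2]
  exact pow_lt_pow_left₀ h2 h3.le two_ne_zero

lemma ConvexOn.le_secant (hc : ConvexOn ℝ (Ioi 0) f) (ha : 0 < a) {x y : ℝ} (hx : 0 < x)
    (hy : 0 < y) : f (a + x) * (x + y) ≤ f a * y + f (a + x + y) * x := by
  have w1 : 0 ≤ y / (x + y) := by positivity
  have w2 : 0 ≤ x / (x + y) := by positivity
  have w3 : y / (x + y) + x / (x + y) = 1 := by field_simp; ring
  have h := hc.2 (mem_Ioi.2 ha) (mem_Ioi.2 (show 0 < a + x + y by positivity)) w1 w2 w3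
  simp only [smul_eq_mul] at h
  have e1 : y / (x + y) * a + x / (x + y) * (a + x + y) = a + x := by field_simp; ring
  rw [e1] at h
  calc f (a + x) * (x + y) ≤ (y / (x + y) * f a + x / (x + y) * f (a + x + y)) * (x + y) := by
        gcongr
    _ = f a * y + f (a + x + y) * x := by field_simp

open StressState in
lemma hasSubsolutionFan_of_width {p ε : ℝ → ℝ} (he : e = fun t => ε t⁻¹)
    (hf : f = fun t => p t⁻¹) (ha : 0 < a) (hT : 0 < b - a) (hconv : ConvexOn ℝ (Ioi 0) f)
    {V w y z c d₁ d₂ x K M k j B q S : ℝ} (hST : S * (b - a) = f a - f b)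
    (hM0 : f a - f (a + x) ≤ M * x) (hq : q = f a - K ^ 2 * x ^ 3) (hx : 0 < x) (hd₁ : 0 < d₁)
    (hd₂ : 0 < d₂) (hBpos : 0 < B) (hBlt : B < b - a - x) (hkj : k < j) (gkg : 0 < k - K * x)
    (hvel : k * B + j * (b - a - x - B) = V - K * x ^ 2)
    (hpres : k ^ 2 * B + j ^ 2 * (b - a - x - B) = f a - f b - K ^ 2 * x ^ 3)
    (hkP : k ^ 2 * (b - a - x) < f a - f b - K ^ 2 * x ^ 3)
    (hu : k * y = k * c + -(K * x) * (c - z)) (gS : 0 < S - K ^ 2 * x ^ 2)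
    (gdet : 0 < d₂ / (a + x) * (S - K ^ 2 * x ^ 2) - K ^ 2 * x * (c - z) ^ 2)
    (gR : 0 < K * (e (a + x) - e a + (q + f a) * x / 2 + (c ^ 2 - z ^ 2) / 2
      + (d₂ + (q - f (a + x)) * (a + x)) / 2) - M * |w + K * x ^ 2|)
    (gL : 0 < j * (e b - e (a + x + B) + (f b + (q - k ^ 2 * B)) * (b - a - x - B) / 2
      - (d₁ + (q - k ^ 2 * B - f (a + x + B)) * (a + x + B)) / 2)
      + (q - k ^ 2 * B - f (a + x + B)) * (w + K * x ^ 2 + k * B))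
    (gM : 0 < k * (e (a + x + B) - e (a + x) + (q - k ^ 2 * B + q) * B / 2
      + (y ^ 2 - c ^ 2 + (d₁ + (q - k ^ 2 * B - f (a + x + B)) * (a + x + B))
        - (d₂ + (q - f (a + x)) * (a + x))) / 2)
      - (q - k ^ 2 * B - f (a + x + B)) * (w + K * x ^ 2 + k * B)
      + (q - f (a + x)) * (w + K * x ^ 2)) :
    HasSubsolutionFan p ε ⟨b⁻¹, y, w + V, 0, 0, 0⟩ ⟨a⁻¹, z, w, 0, 0, 0⟩ := by
  have hA : 0 < b - a - x - B := by linarith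
  have hchord := hconv.le_secant ha hx (by linarith : 0 < b - a - x)
  rw [show a + x + (b - a - x) = b by ring] at hchord
  have hr₂ : x * (S - K ^ 2 * x ^ 2) ≤ q - f (a + x) := by
    have : f (a + x) ≤ f a - S * x :=
      le_of_mul_le_mul_right (by linear_combination hchord + x * hST) hT
    rw [hq]
    linear_combination this
  have hr₂pos : 0 < q - f (a + x) := (mul_pos hx gS).trans_le hr₂
  have hr₂le : q - f (a + x) ≤ M * x := by
    have : 0 ≤ K ^ 2 * x ^ 3 := by positivity
    rw [hq]
    linarith
  have hr₁pos : 0 < q - k ^ 2 * B - f (a + x + B) := by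
    have h := hconv.le_secant (a := a + x) (x := B) (y := b - a - x - B) (by linarith) hBpos hA
    rw [show a + x + B + (b - a - x - B) = b by ring] at h
    have h1 := mul_pos hr₂pos hA
    have h2 : k ^ 2 * (b - a - x) * B < (f a - f b - K ^ 2 * x ^ 3) * B :=
      mul_lt_mul_of_pos_right hkP hBpos
    have h3 : (f a - f b - K ^ 2 * x ^ 3) * B = (q - f b) * B := by rw [hq]; ring
    refine pos_of_mul_pos_left (b := b - a - x) ?_ (by linarith)
    linear_combination h + h1 + h2 + h3
  have hb : b = a + x + B + (b - a - x - B) := by ring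
  have hp : ∀ t, p t⁻¹ = f t := fun t => by rw [hf]
  have hε : ∀ t, ε t⁻¹ = e t := fun t => by rw [he]
  rw [hb]
  refine hasSubsolutionFan_of_massFlux (j := j) (k := k) (g := -(K * x)) (u := c) (d₁ := d₁)
    (d₂ := d₂) (r₁ := q - k ^ 2 * B - f (a + x + B)) (r₂ := q - f (a + x)) ha hx hA hBpos hkj
    (by linarith) ?_ hu ?_ ?_ ?_ hd₁ hd₂ hr₁pos ?_ ?_ ?_ ?_
  all_goals try
    simp only [hp, hε, ← hb]
  · linarith
  · rw [hq]; ring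
  · rw [hq]; ring
  · linarith
  · have h1 := mul_le_mul_of_nonneg_left hr₂ (show 0 ≤ d₂ / (a + x) by positivity)
    have h2 := mul_pos hx gdet
    linarith
  · refine gL.le.trans_eq ?_
    ring
  · refine gM.le.trans_eq ?_
    ring
  · have h1 := mul_pos hx gR
    have h2 : (q - f (a + x)) * (w + K * x ^ 2) ≤ M * x * |w + K * x ^ 2| :=
      (mul_le_mul_of_nonneg_left (le_abs_self _) hr₂pos.le).trans
        (mul_le_mul_of_nonneg_right hr₂le (abs_nonneg _))
    refine le_of_eq_of_le ?_ (h2.trans (sub_nonneg.1 (h1.le.trans_eq ?_)))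
    · ring
    · ring

open StressState in
/-- A shock between specific volumes `b` and `a` with slightly too small velocity jump `V` can be
replaced by a fan of two subsolution states. -/
lemma hasSubsolutionFan_of_margins {p ε : ℝ → ℝ} (he : e = fun t => ε t⁻¹)
    (hf : f = fun t => p t⁻¹) (ha : 0 < a) (hab : a < b) (hfab : f b < f a)
    (hec : ∀ t, 0 < t → ContinuousAt e t) (hfc : ∀ t, 0 < t → ContinuousAt f t)
    (hconv : ConvexOn ℝ (Ioi 0) f) {V w y z d₁ d₂ : ℝ} (hV : 0 < V) (hd₁ : 0 < d₁) (hd₂ : 0 < d₂)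
    (hQ : y ^ 2 + d₂ - z ^ 2 ≠ 0) (hs : 0 < fluxExcess V (b - a) (f a - f b))
    (hL : 0 < leftMargin e f b d₁ V (b - a) (f a - f b) (f a) a w)
    (hM : 0 < midMargin e f d₁ d₂ V (b - a) (f a - f b) (f a) a w 0) :
    HasSubsolutionFan p ε ⟨b⁻¹, y, w + V, 0, 0, 0⟩ ⟨a⁻¹, z, w, 0, 0, 0⟩ := by
  have hT : 0 < b - a := by linarith
  set S := (f a - f b) / (b - a) with hS
  have hS0 : 0 < S := div_pos (by linarith) hT
  set M := (f (a / 2) - f a) / (a / 2) with hMdef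
  have hM0 : ∀ x, 0 < x → f a - f (a + x) ≤ M * x := by
    intro x hx
    have h := hconv.le_secant (a := a / 2) (x := a / 2) (y := x) (by positivity) (by positivity) hx
    rw [add_halves] at h
    rw [hMdef, div_mul_eq_mul_div, le_div_iff₀ (by positivity)]
    linarith
  have hMpos : 0 < M := by
    have h := hM0 (b - a) hT
    rw [add_sub_cancel] at h
    by_contra! hc
    nlinarith
  set Q := y ^ 2 + d₂ - z ^ 2 with hQdef
  set K := 2 * (M * (|w| + 1) + 1) / Q with hK
  have hKQ : K * Q = 2 * (M * (|w| + 1) + 1) := div_mul_cancel₀ _ hQ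
  let W : ℝ → ℝ := fun x => V - K * x ^ 2
  let T : ℝ → ℝ := fun x => b - a - x
  let P : ℝ → ℝ := fun x => f a - f b - K ^ 2 * x ^ 3
  let q : ℝ → ℝ := fun x => f a - K ^ 2 * x ^ 3
  let τ : ℝ → ℝ := fun x => a + x
  let v : ℝ → ℝ := fun x => w + K * x ^ 2
  let u : ℝ → ℝ := fun x => (W x / T x / 2 * y - K * x * z) / (W x / T x / 2 - K * x)
  have cW : ContinuousAt W 0 := by fun_prop
  have cT : ContinuousAt T 0 := by fun_prop
  have cP : ContinuousAt P 0 := by fun_prop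
  have cq : ContinuousAt q 0 := by fun_prop
  have cτ : ContinuousAt τ 0 := by fun_prop
  have cv : ContinuousAt v 0 := by fun_prop
  have W0 : W 0 = V := by simp [W]
  have T0 : T 0 = b - a := by simp [T]
  have P0 : P 0 = f a - f b := by simp [P]
  have q0 : q 0 = f a := by simp [q]
  have τ0 : τ 0 = a := by simp [τ]
  have v0 : v 0 = w := by simp [v]
  have hT0 : 0 < T 0 := by rwa [T0]
  have hW0 : 0 < W 0 := by rwa [W0]
  have hτ0 : 0 < τ 0 := by rwa [τ0]
  have hs0 : 0 < fluxExcess (W 0) (T 0) (P 0) := by rwa [W0, T0, P0]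
  have ck : ContinuousAt (fun x => W x / T x / 2) 0 := (cW.div cT hT0.ne').div_const 2
  have hk0 : 0 < W 0 / T 0 / 2 := by positivity
  have ckg : ContinuousAt (fun x => W x / T x / 2 - K * x) 0 := ck.sub (by fun_prop)
  have hkg0 : 0 < W 0 / T 0 / 2 - K * 0 := by rwa [mul_zero, sub_zero]
  have cu : ContinuousAt u 0 :=
    ((ck.mul continuousAt_const).sub (by fun_prop)).div ckg hkg0.ne'
  have u0 : u 0 = y := by
    simp only [u, mul_zero, zero_mul, sub_zero]
    field_simp
  have cL := continuousAt_leftMargin b d₁ hec hfc cW cT cP cq cτ cv hT0 hW0 hτ0 hs0.le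
  have cM := continuousAt_midMargin (h := fun x => y ^ 2 - u x ^ 2) d₁ d₂ hec hfc cW cT cP cq cτ cv
    (continuousAt_const.sub (cu.pow 2)) hT0 hW0 hτ0 hs0.le
  have eL : 0 < leftMargin e f b d₁ (W 0) (T 0) (P 0) (q 0) (τ 0) (v 0) := by
    rwa [W0, T0, P0, q0, τ0, v0]
  have eM : 0 < midMargin e f d₁ d₂ (W 0) (T 0) (P 0) (q 0) (τ 0) (v 0) (y ^ 2 - u 0 ^ 2) := by
    rwa [W0, T0, P0, q0, τ0, v0, u0, sub_self]
  have cS : ContinuousAt (fun x => S - K ^ 2 * x ^ 2) 0 := by fun_prop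
  have cdet : ContinuousAt (fun x => d₂ / τ x * (S - K ^ 2 * x ^ 2) - K ^ 2 * x * (u x - z) ^ 2) 0 :=
    ((continuousAt_const.div cτ hτ0.ne').mul cS).sub
      ((by fun_prop : ContinuousAt (fun x : ℝ => K ^ 2 * x) 0).mul
        ((cu.sub continuousAt_const).pow 2))
  have edet : 0 < d₂ / τ 0 * (S - K ^ 2 * 0 ^ 2) - K ^ 2 * 0 * (u 0 - z) ^ 2 := by
    rw [τ0]
    simp only [ne_eq, OfNat.ofNat_ne_zero, not_false_eq_true, zero_pow, mul_zero, zero_mul,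
      sub_zero]
    positivity
  have cE : ContinuousAt (fun x => e (τ x)) 0 := (hec _ hτ0).comp cτ
  have cF : ContinuousAt (fun x => f (τ x)) 0 := (hfc _ hτ0).comp cτ
  have cR : ContinuousAt (fun x => K * (e (τ x) - e a + (q x + f a) * x / 2
      + (u x ^ 2 - z ^ 2) / 2 + (d₂ + (q x - f (τ x)) * τ x) / 2) - M * |v x|) 0 := by
    fun_prop
  have eR : 0 < K * (e (τ 0) - e a + (q 0 + f a) * 0 / 2
      + (u 0 ^ 2 - z ^ 2) / 2 + (d₂ + (q 0 - f (τ 0)) * τ 0) / 2) - M * |v 0| := by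
    rw [τ0, q0, u0, v0]
    linarith
  have ev := (cT.eventually_const_lt hT0).and ((cW.eventually_const_lt hW0).and
    (((continuousAt_fluxExcess cW cT cP hT0.ne').eventually_const_lt hs0).and
    ((cL.eventually_const_lt eL).and ((cM.eventually_const_lt eM).and
    ((ckg.eventually_const_lt hkg0).and ((cS.eventually_const_lt (u := 0) (by simpa using hS0)).and
    ((cdet.eventually_const_lt edet).and (cR.eventually_const_lt eR))))))))
  obtain ⟨x, ⟨gT, gW, gs, gL, gM, gkg, gS, gdet, gR⟩, hx⟩ :=
    ((ev.filter_mono (nhdsWithin_le_nhds (s := Ioi (0 : ℝ)))).and self_mem_nhdsWithin).exists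
  replace hx : 0 < x := hx
  clear ev cL cM cS cdet cE cF cR eL eM edet eR cW cT cP cq cτ cv ck ckg cu
  have hvel := velocity_split gW gT gs
  have hpres := pressure_split gW gT gs
  have hBpos := slowWidth_pos gT gs
  have hBlt := slowWidth_lt gW gT gs
  have hkj := slowFlux_lt_fastFlux gW gT gs
  have hkP := slowFlux_sq_mul_lt gW gT gs
  have hu : W x / T x / 2 * y = W x / T x / 2 * u x + -(K * x) * (u x - z) := by
    have : u x * (W x / T x / 2 - K * x) = W x / T x / 2 * y - K * x * z :=
      div_mul_cancel₀ _ gkg.ne'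
    linarith
  exact hasSubsolutionFan_of_width he hf ha hT hconv (div_mul_cancel₀ _ hT.ne') (hM0 x hx) rfl hx
    hd₁ hd₂ hBpos hBlt hkj gkg hvel hpres hkP hu gS gdet gR gL gM

end ShockPerturbation

section GammaLaw

variable {e f : ℝ → ℝ} {a b : ℝ}

/-- The trapezoidal rule strictly overestimates the integral of a strictly convex function. -/
lemma StrictConvexOn.trapezoid_lt (hc : StrictConvexOn ℝ (Ioi 0) f)
    (he : ∀ t, 0 < t → HasDerivAt e (-f t) t) (ha : 0 < a) (hab : a < b) :
    0 < 2 * (e b - e a) + (f a + f b) * (b - a) := by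
  have hT : 0 < b - a := sub_pos.2 hab
  have hd : ∀ t, 0 < t → HasDerivAt
      (fun t => e t + f a * (t - a) + (f b - f a) / (b - a) * ((t - a) ^ 2 / 2))
      (-f t + f a + (f b - f a) / (b - a) * (t - a)) t := by
    intro t ht
    have h1 := (hasDerivAt_id t).sub_const a
    have h2 := ((he t ht).add (h1.const_mul (f a))).add
      (((h1.pow 2).div_const 2).const_mul ((f b - f a) / (b - a)))
    refine h2.congr_deriv ?_
    simp
  have hmono := strictMonoOn_of_deriv_pos (convex_Icc a b)
    (fun t ht => (hd t (ha.trans_le ht.1)).continuousAt.continuousWithinAt) (by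
      intro t ht
      rw [interior_Icc] at ht
      rw [(hd t (ha.trans ht.1)).deriv]
      have h := hc.secant_strict_mono_aux2 (mem_Ioi.2 ha) (mem_Ioi.2 (ha.trans hab)) ht.1 ht.2
      rw [div_lt_iff₀ (sub_pos.2 ht.1)] at h
      linarith)
  have h := hmono (left_mem_Icc.2 hab.le) (right_mem_Icc.2 hab.le) hab
  have h2 : (f b - f a) / (b - a) * ((b - a) ^ 2 / 2) = (f b - f a) * (b - a) / 2 := by
    field_simp
  simp only [h2, sub_self] at h
  linarith

lemma exists_hasSubsolutionFan {p ε : ℝ → ℝ} (he : e = fun t => ε t⁻¹)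
    (hf : f = fun t => p t⁻¹) (ha : 0 < a) (hab : a < b) (hfab : f b < f a)
    (hed : ∀ t, 0 < t → HasDerivAt e (-f t) t) (hfc : ∀ t, 0 < t → ContinuousAt f t)
    (hconv : StrictConvexOn ℝ (Ioi 0) f) {w : ℝ → ℝ} (hw : Continuous w) :
    ∃ V₀ < √((f a - f b) * (b - a)), ∀ V, V₀ < V → V < √((f a - f b) * (b - a)) →
      ∀ y z, HasSubsolutionFan p ε ⟨b⁻¹, y, w V + V, 0, 0, 0⟩ ⟨a⁻¹, z, w V, 0, 0, 0⟩ := by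
  have hec : ∀ t, 0 < t → ContinuousAt e t := fun t ht => (hed t ht).continuousAt
  have hD := hconv.trapezoid_lt hed ha hab
  set D := 2 * (e b - e a) + (f a + f b) * (b - a) with hDef
  obtain ⟨V₀, hV₀, h⟩ := exists_margins_pos ha hab hfab hec hfc hD hDef hw
  refine ⟨V₀, hV₀, fun V hV hV' y z => ?_⟩
  obtain ⟨h0, hs, hL, hM, hM'⟩ := h V hV hV'
  by_cases hQ : y ^ 2 + D / 4 - z ^ 2 = 0
  · exact hasSubsolutionFan_of_margins he hf ha hab hfab hec hfc hconv.convexOn h0 (by positivity)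
      (by positivity) (fun h => by linarith) hs hL hM'
  · exact hasSubsolutionFan_of_margins he hf ha hab hfab hec hfc hconv.convexOn h0 (by positivity)
      (by positivity) hQ hs hL hM

variable {γ : ℝ}

lemma pressure_inv {t : ℝ} (ht : 0 < t) : pressure γ t⁻¹ = t ^ (-γ) := by
  rw [pressure, Real.inv_rpow ht.le, Real.rpow_neg ht.le]

lemma hasDerivAt_intEnergy_inv {t : ℝ} (ht : 0 < t) :
    HasDerivAt (fun t => intEnergy γ t⁻¹) (-pressure γ t⁻¹) t := by
  rw [pressure_inv ht]
  by_cases hγ : γ = 1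
  · have h : (fun t => intEnergy γ t⁻¹) = fun t => -Real.log t := by
      ext t
      simp [intEnergy, hγ]
    rw [h, hγ, Real.rpow_neg_one]
    exact (Real.hasDerivAt_log ht.ne').neg
  · have hγ' : γ - 1 ≠ 0 := sub_ne_zero.2 hγ
    have h : (fun t => intEnergy γ t⁻¹) =ᶠ[nhds t] fun t => t ^ (1 - γ) / (γ - 1) := by
      filter_upwards [lt_mem_nhds ht] with s hs
      rw [intEnergy, if_neg hγ, Real.inv_rpow hs.le, ← Real.rpow_neg hs.le, neg_sub]
    refine HasDerivAt.congr_of_eventuallyEq ?_ h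
    refine ((Real.hasDerivAt_rpow_const (p := 1 - γ) (Or.inl ht.ne')).div_const
      (γ - 1)).congr_deriv ?_
    rw [show 1 - γ - 1 = -γ by ring]
    field_simp
    ring

lemma continuousAt_pressure_inv {t : ℝ} (ht : 0 < t) :
    ContinuousAt (fun t => pressure γ t⁻¹) t :=
  (continuousAt_inv₀ ht.ne').rpow_const (Or.inl (inv_pos.2 ht).ne')

lemma strictConvexOn_pressure_inv (hγ : 0 < γ) :
    StrictConvexOn ℝ (Ioi 0) fun t => pressure γ t⁻¹ := by
  refine StrictConvexOn.congr (f := fun t : ℝ => t ^ (-γ)) ?_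
    fun t ht => (pressure_inv ht).symm
  refine StrictMonoOn.strictConvexOn_of_deriv (convex_Ioi 0)
    (fun t ht => (Real.continuousAt_rpow_const t _ (Or.inl ht.ne')).continuousWithinAt) ?_
  rw [interior_Ioi]
  intro s hs t ht hst
  rw [Real.deriv_rpow_const, Real.deriv_rpow_const]
  have := Real.rpow_lt_rpow_of_neg hs hst (show -γ - 1 < 0 by linarith)
  nlinarith

lemma pressure_lt (hγ : 0 < γ) {r s : ℝ} (hr : 0 < r) (hrs : r < s) :
    pressure γ r < pressure γ s :=
  Real.rpow_lt_rpow hr.le hrs hγ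

/-- Two intermediate subsolution states exist if the velocity jump is slightly smaller than the
one of a single shock; `r` is the density of the less dense state. -/
lemma exists_hasSubsolutionFan_pressure (hγ : 0 < γ) {r s : ℝ} (hr : 0 < r) (hrs : r < s)
    {w : ℝ → ℝ} (hw : Continuous w) :
    ∃ V₀ < √((s - r) * (pressure γ s - pressure γ r) / (s * r)), ∀ V, V₀ < V →
      V < √((s - r) * (pressure γ s - pressure γ r) / (s * r)) →
      ∀ y z, HasSubsolutionFan (pressure γ) (intEnergy γ)
        ⟨r, y, w V + V, 0, 0, 0⟩ ⟨s, z, w V, 0, 0, 0⟩ := by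
  have hs : 0 < s := hr.trans hrs
  have h := exists_hasSubsolutionFan (p := pressure γ) (ε := intEnergy γ) rfl rfl
    (inv_pos.2 hs) ((inv_lt_inv₀ hs hr).2 hrs) (by simpa using pressure_lt hγ hr hrs)
    (fun t ht => hasDerivAt_intEnergy_inv ht) (fun t ht => continuousAt_pressure_inv ht)
    (strictConvexOn_pressure_inv hγ) hw
  have hrs' : (pressure γ s - pressure γ r) * (r⁻¹ - s⁻¹) =
      (s - r) * (pressure γ s - pressure γ r) / (s * r) := by
    field_simp
  simpa only [inv_inv, hrs'] using h

end GammaLaw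

/-- For `p(ρ) = ρ^γ`, `γ ≥ 1`, `ρ₋ ≠ ρ₊` positive and any `v₊₂`, there is
`V̄ = V̄(ρ₋,ρ₊,v₊₂,γ) < √((ρ₊ − ρ₋)(p(ρ₊) − p(ρ₋))/(ρ₊ρ₋))` such that for arbitrary
`v₋₁, v₊₁` and any `v₋₂` with `V̄ < v₋₂ − v₊₂ < √(...)` there exists an admissible fan
subsolution with the corresponding Riemann data. -/
theorem exists_admissible_fan_subsolution_shock_rarefaction
    (γ : ℝ) (hγ : 1 ≤ γ) (ρm ρp : ℝ) (hρm : 0 < ρm) (hρp : 0 < ρp) (hne : ρm ≠ ρp)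
    (vp2 : ℝ) :
    ∃ Vbar : ℝ,
      Vbar < Real.sqrt ((ρp - ρm) * (pressure γ ρp - pressure γ ρm) / (ρp * ρm)) ∧
      ∀ vm1 vp1 vm2 : ℝ,
        Vbar < vm2 - vp2 →
        vm2 - vp2 < Real.sqrt ((ρp - ρm) * (pressure γ ρp - pressure γ ρm) / (ρp * ρm)) →
        ∃ (νm ν1 νp ρ1 ρ2 : ℝ) (v1 v2 : Fin 2 → ℝ) (u1 u2 : Matrix (Fin 2) (Fin 2) ℝ)
          (C1 C2 : ℝ),
          IsAdmissibleFanSubsolution (pressure γ) (intEnergy γ) ρm ρp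
            ![vm1, vm2] ![vp1, vp2] νm ν1 νp ρ1 ρ2 v1 v2 u1 u2 C1 C2 := by
  have hγ' : 0 < γ := by linarith
  suffices h : ∃ Vbar < √((ρp - ρm) * (pressure γ ρp - pressure γ ρm) / (ρp * ρm)),
      ∀ vm1 vp1 vm2 : ℝ, Vbar < vm2 - vp2 →
        vm2 - vp2 < √((ρp - ρm) * (pressure γ ρp - pressure γ ρm) / (ρp * ρm)) →
        HasSubsolutionFan (pressure γ) (intEnergy γ)
          ⟨ρm, vm1, vm2, 0, 0, 0⟩ ⟨ρp, vp1, vp2, 0, 0, 0⟩ by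
    obtain ⟨Vbar, hV, h⟩ := h
    refine ⟨Vbar, hV, fun vm1 vp1 vm2 h1 h2 => ?_⟩
    obtain ⟨νm, ν1, νp, S₁, S₂, h12, h23, hS₁, hS₂, jm, j1, jp⟩ := h vm1 vp1 vm2 h1 h2
    exact ⟨_, _, _, _, _, _, _, _, _, _, _,
      isAdmissibleFanSubsolution_of_jump h12 h23 hS₁ hS₂ jm j1 jp⟩
  rcases lt_or_gt_of_ne hne with hlt | hlt
  · obtain ⟨V₀, hV₀, h⟩ := exists_hasSubsolutionFan_pressure hγ' hρm hlt
      (w := fun _ => vp2) continuous_const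
    refine ⟨V₀, hV₀, fun vm1 vp1 vm2 h1 h2 => ?_⟩
    simpa using h _ h1 h2 vm1 vp1
  · obtain ⟨V₀, hV₀, h⟩ := exists_hasSubsolutionFan_pressure hγ' hρp hlt
      (w := fun V => -vp2 - V) (by fun_prop)
    have hsymm : (ρm - ρp) * (pressure γ ρm - pressure γ ρp) / (ρm * ρp) =
        (ρp - ρm) * (pressure γ ρp - pressure γ ρm) / (ρp * ρm) := by
      rw [mul_comm ρm ρp]
      ring
    rw [hsymm] at hV₀ h
    refine ⟨V₀, hV₀, fun vm1 vp1 vm2 h1 h2 => ?_⟩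
    simpa [StressState.reflect] using (h _ h1 h2 vp1 vm1).reflect

end
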